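/- arXiv:1511.02982 — 2 statements merged into one kernel-verified Lean document; each statement's English description precedes it below -/
import Mathlib

section
/- Let X ⊆ cl(𝔹_d) and let z ∈ Z(I(X)) ∩ 𝔹_d be a point that is not isolated in Z(I(X)) ∩ 𝔹_d. Then Z(I(X)) ∩ 𝕊_d is nonempty, and for every φ ∈ A(𝔹_d) one has |φ(z)| ≤ sup{ |φ(ζ)| : ζ ∈ Z(I(X)) ∩ 𝕊_d }. -/
open MeasureTheory Metric Set Filter Topology

noncomputable section

abbrev CB (d : ℕ) : Set (EuclideanSpace ℂ (Fin d)) := Metric.closedBall 0 1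

instance (d : ℕ) : CompactSpace (CB d) :=
  isCompact_iff_compactSpace.mp (isCompact_closedBall _ _)

instance (d : ℕ) : MeasurableSpace (EuclideanSpace ℂ (Fin d)) := borel _

instance (d : ℕ) : BorelSpace (EuclideanSpace ℂ (Fin d)) := ⟨rfl⟩

def polyAlg (d : ℕ) : Subalgebra ℂ C(CB d, ℂ) :=
  Algebra.adjoin ℂ
    { f : C(CB d, ℂ) | ∃ i : Fin d,
        f = ⟨fun z => (z : EuclideanSpace ℂ (Fin d)) i,
             (EuclideanSpace.proj (𝕜 := ℂ) i).continuous.comp continuous_subtype_val⟩ }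

def ballAlgSub (d : ℕ) : Subalgebra ℂ C(CB d, ℂ) := (polyAlg d).topologicalClosure

def ballAlg (d : ℕ) : Set C(CB d, ℂ) := ballAlgSub d

def sphereD (d : ℕ) : Set (CB d) := {z | ‖(z : EuclideanSpace ℂ (Fin d))‖ = 1}

def openD (d : ℕ) : Set (CB d) := {z | ‖(z : EuclideanSpace ℂ (Fin d))‖ < 1}

def ZS (d : ℕ) (S : Set C(CB d, ℂ)) : Set (CB d) := {z | ∀ φ ∈ S, φ z = 0}

def IX (d : ℕ) (X : Set (CB d)) : Set C(CB d, ℂ) :=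
  {φ | φ ∈ ballAlg d ∧ ∀ z ∈ X, φ z = 0}

def IsZeroSet (d : ℕ) (X : Set (CB d)) : Prop :=
  ∃ S ⊆ ballAlg d, X = ZS d S

/-- A representing measure for a point of the closed ball: a finite positive regular
Borel measure integrating every function of the ball algebra to its value at the point. -/
def IsRepMeasure (d : ℕ) (lam : CB d) (μ : Measure (CB d)) : Prop :=
  IsFiniteMeasure μ ∧ μ.Regular ∧ ∀ φ ∈ ballAlg d, φ lam = ∫ z, φ z ∂μ

/-- `X̂₀` : `X₀` together with all points of the open ball having a representing measure
supported on `X₀`. -/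
def hatSet (d : ℕ) (X0 : Set (CB d)) : Set (CB d) :=
  X0 ∪ {lam | lam ∈ openD d ∧
    ∃ μ : Measure (CB d), IsRepMeasure d lam μ ∧ μ X0ᶜ = 0}

/-- `z` is an isolated point of the set `A`. -/
def IsIsolatedIn (d : ℕ) (A : Set (CB d)) (z : CB d) : Prop :=
  z ∈ A ∧ ∃ U : Set (CB d), IsOpen U ∧ U ∩ A = {z}

/-- A closed ideal of the ball algebra. -/
structure IsClosedIdeal (d : ℕ) (J : Set C(CB d, ℂ)) : Prop where
  subset : J ⊆ ballAlg d
  closed : IsClosed J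
  zero_mem : (0 : C(CB d, ℂ)) ∈ J
  add_mem : ∀ f ∈ J, ∀ g ∈ J, f + g ∈ J
  smul_mem : ∀ (c : ℂ), ∀ f ∈ J, c • f ∈ J
  mul_mem : ∀ f ∈ ballAlg d, ∀ g ∈ J, f * g ∈ J

/-- An `A(𝔹_d)`-Henkin (finite positive regular Borel) measure on the sphere. -/
def IsHenkin (d : ℕ) (μ : Measure (CB d)) : Prop :=
  IsFiniteMeasure μ ∧ μ.Regular ∧ μ (sphereD d)ᶜ = 0 ∧
    ∀ f : ℕ → C(CB d, ℂ), (∀ n, f n ∈ ballAlg d) → (∃ C : ℝ, ∀ n, ‖f n‖ ≤ C) →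
      (∀ z ∈ openD d, Tendsto (fun n => f n z) atTop (𝓝 0)) →
      Tendsto (fun n => ∫ z, f n z ∂μ) atTop (𝓝 0)

/-- An `A(𝔹_d)`-totally null subset of the sphere. -/
def IsTotallyNull (d : ℕ) (K : Set (CB d)) : Prop :=
  K ⊆ sphereD d ∧ ∀ μ : Measure (CB d), IsHenkin d μ → μ K = 0

/-- A complex regular Borel measure on the sphere, given by its polar decomposition:
total variation `var` (a finite positive regular Borel measure concentrated on the
sphere) and a unimodular density. -/
structure CMeasure (d : ℕ) where
  var : Measure (CB d)
  density : CB d → ℂ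
  finite : IsFiniteMeasure var
  regular : var.Regular
  measurable_density : Measurable density
  norm_density : ∀ z, ‖density z‖ = 1
  onSphere : var (sphereD d)ᶜ = 0

/-- Integral of a continuous function against a complex measure. -/
def cInt (d : ℕ) (μ : CMeasure d) (φ : C(CB d, ℂ)) : ℂ :=
  ∫ z, φ z * μ.density z ∂μ.var

/-- An `A(𝔹_d)`-Henkin complex measure on the sphere. -/
def IsHenkinC (d : ℕ) (μ : CMeasure d) : Prop :=
  ∀ f : ℕ → C(CB d, ℂ), (∀ n, f n ∈ ballAlg d) → (∃ C : ℝ, ∀ n, ‖f n‖ ≤ C) →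
    (∀ z ∈ openD d, Tendsto (fun n => f n z) atTop (𝓝 0)) →
    Tendsto (fun n => cInt d μ (f n)) atTop (𝓝 0)

/-- An `A(𝔹_d)`-totally singular complex measure: its total variation is mutually
singular with that of every Henkin complex measure. -/
def IsTotallySingularC (d : ℕ) (μ : CMeasure d) : Prop :=
  ∀ ν : CMeasure d, IsHenkinC d ν → μ.var ⟂ₘ ν.var

/-- An `A(𝔹_d)`-totally null Borel subset of the sphere (complex-measure version). -/
def IsTotallyNullC (d : ℕ) (K : Set (CB d)) : Prop :=
  K ⊆ sphereD d ∧ ∀ μ : CMeasure d, IsHenkinC d μ → μ.var K = 0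

section HolomorphicAlongLines

universe u

theorem differentiableAt_intervalIntegral_param {k : ℂ → ℝ → ℂ} {δ a b : ℝ} (hδ : 0 < δ)
    (hab : a ≤ b)
    (hc : ContinuousOn (Function.uncurry k) (ball 0 δ ×ˢ univ))
    (hd : ∀ θ, DifferentiableOn ℂ (fun s => k s θ) (ball 0 δ)) :
    DifferentiableAt ℂ (fun s => ∫ θ in a..b, k s θ) 0 := by
  have hsub : closedBall (0 : ℂ) (δ / 2) ⊆ ball 0 δ := closedBall_subset_ball (by linarith)
  obtain ⟨C, hC⟩ := ((isCompact_closedBall (0 : ℂ) (δ / 2)).prod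
    (isCompact_Icc (a := a) (b := b))).exists_bound_of_continuousOn
      (hc.mono (prod_mono hsub (subset_univ _)))
  have hk : ∀ s ∈ ball (0 : ℂ) δ, Continuous (k s) := fun s hs => by
    rw [← continuousOn_univ]
    exact hc.comp (f := fun θ => (s, θ)) (by fun_prop) fun θ _ => ⟨hs, mem_univ _⟩
  have h0 : (0 : ℂ) ∈ ball (0 : ℂ) δ := mem_ball_self hδ
  have hder : ∀ θ, ∀ s ∈ ball (0 : ℂ) δ, HasDerivAt (fun s => k s θ) (deriv (fun s => k s θ) s) s :=
    fun θ s hs => ((hd θ).differentiableAt (isOpen_ball.mem_nhds hs)).hasDerivAt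
  have hball : ball (0 : ℂ) (δ / 4) ∈ 𝓝 (0 : ℂ) := ball_mem_nhds _ (by linarith)
  refine (intervalIntegral.hasDerivAt_integral_of_dominated_loc_of_deriv_le
    (F' := fun s θ => deriv (fun s => k s θ) s) (bound := fun _ => C / (δ / 4)) hball ?_ ?_ ?_ ?_ ?_
      ?_).2.differentiableAt
  · filter_upwards [isOpen_ball.mem_nhds h0] with s hs
    exact (hk s hs).aestronglyMeasurable
  · exact (hk 0 h0).intervalIntegrable _ _
  · let u : ℕ → ℂ := fun n => ((δ / 2 / (n + 1 : ℝ) : ℝ) : ℂ)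
    have hu0 : ∀ n : ℕ, 0 < δ / 2 / (n + 1 : ℝ) := fun n =>
      div_pos (by linarith) (by positivity)
    have hu : Tendsto u atTop (𝓝[≠] 0) := by
      refine tendsto_nhdsWithin_iff.2 ⟨?_, Eventually.of_forall fun n => ?_⟩
      · have h := tendsto_one_div_add_atTop_nhds_zero_nat (𝕜 := ℝ)
        have h2 := h.const_mul (δ / 2)
        rw [mul_zero] at h2
        have h3 := (Complex.continuous_ofReal.tendsto 0).comp h2
        rw [Complex.ofReal_zero] at h3
        refine h3.congr fun n => ?_
        simp [u, div_eq_mul_inv]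
      · simp only [u, mem_compl_iff, mem_singleton_iff, Complex.ofReal_eq_zero]
        exact (hu0 n).ne'
    refine aestronglyMeasurable_of_tendsto_ae (u := atTop)
      (f := fun n θ => (u n)⁻¹ • (k (0 + u n) θ - k 0 θ)) (fun n => ?_) ?_
    · have hn : u n ∈ ball (0 : ℂ) δ := by
        rw [mem_ball_zero_iff, Complex.norm_real, Real.norm_of_nonneg (hu0 n).le]
        refine lt_of_le_of_lt (div_le_self (by linarith) ?_) (by linarith : δ / 2 < δ)
        have := Nat.cast_nonneg (α := ℝ) n
        linarith
      rw [zero_add]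
      have h1 := hk _ hn
      have h2 := hk _ h0
      exact Continuous.aestronglyMeasurable (by fun_prop)
    · exact Eventually.of_forall fun θ => (hder θ 0 h0).tendsto_slope_zero.comp hu
  · refine Eventually.of_forall fun θ hθ s hs => ?_
    rw [uIoc_of_le hab] at hθ
    have hs' : closedBall s (δ / 4) ⊆ closedBall (0 : ℂ) (δ / 2) := by
      refine closedBall_subset_closedBall' ?_
      rw [mem_ball] at hs
      linarith
    refine Complex.norm_deriv_le_of_forall_mem_sphere_norm_le (by linarith) ?_ fun z hz => ?_
    · exact ((hd θ).mono ((closure_ball_subset_closedBall.trans hs').trans hsub)).diffContOnCl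
    · exact hC (z, θ) ⟨hs' (sphere_subset_closedBall hz), Ioc_subset_Icc_self hθ⟩
  · exact intervalIntegrable_const
  · refine Eventually.of_forall fun θ _ s hs => hder θ s ?_
    exact ball_subset_ball (by linarith) hs

variable {E : Type*} [NormedAddCommGroup E] [NormedSpace ℂ E]

/-- Continuity together with holomorphy along every complex line. -/
def LineHol (f : E → ℂ) (U : Set E) : Prop :=
  ContinuousOn f U ∧ ∀ a ∈ U, ∀ v, DifferentiableAt ℂ (fun s : ℂ => f (a + s • v)) 0

namespace LineHol

variable {f g : E → ℂ} {U V : Set E}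

theorem mono (hf : LineHol f U) (h : V ⊆ U) : LineHol f V :=
  ⟨hf.1.mono h, fun a ha v => hf.2 a (h ha) v⟩

theorem const (c : ℂ) : LineHol (fun _ : E => c) U :=
  ⟨continuousOn_const, fun _ _ _ => differentiableAt_const _⟩

theorem add (hf : LineHol f U) (hg : LineHol g U) : LineHol (fun x => f x + g x) U :=
  ⟨hf.1.add hg.1, fun a ha v => (hf.2 a ha v).add (hg.2 a ha v)⟩

theorem sub (hf : LineHol f U) (hg : LineHol g U) : LineHol (fun x => f x - g x) U :=
  ⟨hf.1.sub hg.1, fun a ha v => (hf.2 a ha v).sub (hg.2 a ha v)⟩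

theorem mul (hf : LineHol f U) (hg : LineHol g U) : LineHol (fun x => f x * g x) U :=
  ⟨hf.1.mul hg.1, fun a ha v => (hf.2 a ha v).mul (hg.2 a ha v)⟩

theorem pow (hf : LineHol f U) (n : ℕ) : LineHol (fun x => f x ^ n) U :=
  ⟨hf.1.pow n, fun a ha v => (hf.2 a ha v).pow n⟩

theorem sum {ι : Type*} (s : Finset ι) {F : ι → E → ℂ} (hF : ∀ i ∈ s, LineHol (F i) U) :
    LineHol (fun x => ∑ i ∈ s, F i x) U :=
  ⟨continuousOn_finsetSum s fun i hi => (hF i hi).1,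
    fun a ha v => DifferentiableAt.fun_sum fun i hi => (hF i hi).2 a ha v⟩

theorem congr (hf : LineHol f U) (hU : IsOpen U) (h : ∀ x ∈ U, g x = f x) : LineHol g U := by
  refine ⟨hf.1.congr h, fun a ha v => (hf.2 a ha v).congr_of_eventuallyEq ?_⟩
  have hcont : Continuous fun s : ℂ => a + s • v := by fun_prop
  have : ∀ᶠ s : ℂ in 𝓝 0, a + s • v ∈ U :=
    hcont.continuousAt.eventually (hU.mem_nhds (by simpa using ha))
  filter_upwards [this] with s hs using h _ hs

theorem comp_affine {G : Type*} [NormedAddCommGroup G] [NormedSpace ℂ G] (hf : LineHol f U)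
    {V' : Set G} (L : G →L[ℂ] E) (c : E) (hV : MapsTo (fun x => c + L x) V' U) :
    LineHol (fun x => f (c + L x)) V' := by
  refine ⟨hf.1.comp (by fun_prop) hV, fun a ha v => ?_⟩
  simpa [add_assoc] using hf.2 _ (hV ha) (L v)

theorem differentiableOn_line (hf : LineHol f U) (x v : E) :
    DifferentiableOn ℂ (fun s : ℂ => f (x + s • v)) {s | x + s • v ∈ U} := by
  intro s₀ hs₀
  refine DifferentiableAt.differentiableWithinAt ?_
  have h := hf.2 _ hs₀ v
  have h2 : DifferentiableAt ℂ (fun s : ℂ => s - s₀) s₀ := by fun_prop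
  have h3 : DifferentiableAt ℂ (fun s : ℂ => f (x + s₀ • v + s • v)) (s₀ - s₀) := by
    simpa using h
  refine (DifferentiableAt.comp (f := fun s : ℂ => s - s₀) s₀ h3 h2).congr_of_eventuallyEq
    (Eventually.of_forall fun s => ?_)
  simp [sub_smul]

end LineHol

theorem LineHol.circleIntegral {P : Type*} [NormedAddCommGroup P] [NormedSpace ℂ P]
    {K : P → ℂ → ℂ} {V : Set P} (hV : IsOpen V) {c : ℂ} {r : ℝ} (hr : 0 ≤ r)
    (hc : ContinuousOn (Function.uncurry K) (V ×ˢ sphere c r))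
    (hd : ∀ t ∈ sphere c r, LineHol (fun a => K a t) V) :
    LineHol (fun a => ∮ t in C(c, r), K a t) V := by
  have hcirc : Continuous fun p : V × ℝ =>
      deriv (circleMap c r) p.2 • K p.1 (circleMap c r p.2) := by
    refine Continuous.smul (((contDiff_circleMap c r (n := 1)).continuous_deriv le_rfl).comp
      continuous_snd) ?_
    exact hc.comp_continuous (f := fun p : V × ℝ => (p.1.1, circleMap c r p.2)) (by fun_prop)
      fun p => ⟨p.1.2, circleMap_mem_sphere _ hr _⟩
  refine ⟨?_, fun a ha v => ?_⟩
  · rw [continuousOn_iff_continuous_domRestrict]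
    exact intervalIntegral.continuous_parametric_intervalIntegral_of_continuous'
      (f := fun (a : V) θ => deriv (circleMap c r) θ • K a (circleMap c r θ)) hcirc _ _
  · have hcont : Continuous fun s : ℂ => a + s • v := by fun_prop
    obtain ⟨δ, hδ, hsub⟩ := Metric.mem_nhds_iff.1
      (hcont.continuousAt.preimage_mem_nhds (hV.mem_nhds (show a + (0 : ℂ) • v ∈ V by simpa)))
    refine differentiableAt_intervalIntegral_param hδ Real.two_pi_pos.le ?_ fun θ => ?_
    · rw [continuousOn_iff_continuous_domRestrict]
      exact hcirc.comp (f := fun p : ↥(ball (0 : ℂ) δ ×ˢ (univ : Set ℝ)) =>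
        ((⟨a + p.1.1 • v, hsub p.2.1⟩ : V), p.1.2)) (by fun_prop)
    · simp only [smul_eq_mul]
      refine DifferentiableOn.const_mul ?_ _
      exact ((hd _ (circleMap_mem_sphere _ hr θ)).differentiableOn_line a v).mono hsub

theorem LineHol.deriv_snd {W : Type*} [NormedAddCommGroup W] [NormedSpace ℂ W]
    {f : W × ℂ → ℂ} {V : Set W} (hV : IsOpen V) {R r : ℝ} (hrR : r < R)
    (hf : LineHol f (V ×ˢ ball 0 R)) :
    LineHol (fun p : W × ℂ => deriv (fun t => f (p.1, t)) p.2) (V ×ˢ ball 0 r) := by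
  set ρ : ℝ := (R - r) / 2 with hρ
  have hρ0 : 0 < ρ := by rw [hρ]; linarith
  have hmem : ∀ p ∈ V ×ˢ ball (0 : ℂ) r, ∀ σ ∈ closedBall (0 : ℂ) ρ,
      (p.1, p.2 + σ) ∈ V ×ˢ ball (0 : ℂ) R := by
    rintro p ⟨hp1, hp2⟩ σ hσ
    refine ⟨hp1, ?_⟩
    rw [mem_ball_zero_iff] at hp2 ⊢
    rw [mem_closedBall_zero_iff] at hσ
    have := norm_add_le p.2 σ
    simp only
    linarith
  have key : LineHol (fun p : W × ℂ => ∮ σ in C(0, ρ), (σ ^ 2)⁻¹ * f (p.1, p.2 + σ))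
      (V ×ˢ ball 0 r) := by
    have hopen : IsOpen (V ×ˢ ball (0 : ℂ) r) := hV.prod isOpen_ball
    have hcont : ContinuousOn
        (Function.uncurry fun (p : W × ℂ) (σ : ℂ) => (σ ^ 2)⁻¹ * f (p.1, p.2 + σ))
        ((V ×ˢ ball 0 r) ×ˢ sphere 0 ρ) := by
      have hpow : ContinuousOn (fun q : (W × ℂ) × ℂ => q.2 ^ 2)
          ((V ×ˢ ball 0 r) ×ˢ sphere 0 ρ) := by fun_prop
      have hshift : ContinuousOn (fun q : (W × ℂ) × ℂ => (q.1.1, q.1.2 + q.2))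
          ((V ×ˢ ball 0 r) ×ˢ sphere 0 ρ) := by fun_prop
      exact (hpow.inv₀ fun q hq => pow_ne_zero 2 (ne_of_mem_sphere hq.2 hρ0.ne')).mul
        (hf.1.comp hshift fun q hq => hmem q.1 hq.1 q.2 (sphere_subset_closedBall hq.2))
    have hline : ∀ σ ∈ sphere (0 : ℂ) ρ,
        LineHol (fun p : W × ℂ => (σ ^ 2)⁻¹ * f (p.1, p.2 + σ)) (V ×ˢ ball 0 r) := by
      intro σ hσ
      refine (LineHol.const _).mul ?_
      have := hf.comp_affine (V' := V ×ˢ ball (0 : ℂ) r) (ContinuousLinearMap.id ℂ (W × ℂ))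
        (0, σ) fun p hp => by
          have := hmem p hp σ (sphere_subset_closedBall hσ)
          simpa [add_comm] using this
      simpa [Prod.add_def, add_comm] using this
    exact LineHol.circleIntegral hopen hρ0.le hcont hline
  refine ((LineHol.const ((2 * Real.pi * Complex.I : ℂ)⁻¹)).mul key).congr
    (hV.prod isOpen_ball) fun p hp => ?_
  have hd : DifferentiableOn ℂ (fun σ => f (p.1, p.2 + σ)) {σ | (p.1, p.2 + σ) ∈ V ×ˢ ball 0 R} := by
    simpa [Prod.add_def] using hf.differentiableOn_line p (0, 1)
  have hopen : IsOpen {σ : ℂ | p.2 + σ ∈ ball (0 : ℂ) R} :=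
    isOpen_ball.preimage (by fun_prop)
  have h := Complex.two_pi_I_inv_smul_circleIntegral_sub_sq_inv_smul_of_differentiable
    (c := 0) (w₀ := 0) (R := ρ) (U := {σ : ℂ | p.2 + σ ∈ ball (0 : ℂ) R})
    (f := fun σ => f (p.1, p.2 + σ)) hopen (fun σ hσ => (hmem p hp σ hσ).2)
    (hd.mono fun σ hσ => ⟨hp.1, hσ⟩) (mem_ball_self hρ0)
  simp only [sub_zero, smul_eq_mul] at h
  rw [h, deriv_comp_const_add (fun t => f (p.1, t)) p.2 0, add_zero]

theorem exists_eq_pow_mul_of_differentiableOn {f : ℂ → ℂ} {R : ℝ} {a : ℂ}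
    (ha : a ∈ ball (0 : ℂ) R) (hf : DifferentiableOn ℂ f (ball 0 R))
    (hne : ¬ ∀ᶠ t in 𝓝 a, f t = 0) :
    ∃ (n : ℕ) (u : ℂ → ℂ), DifferentiableOn ℂ u (ball 0 R) ∧ u a ≠ 0 ∧
      ∀ t, f t = (t - a) ^ n * u t := by
  have han : AnalyticAt ℂ f a := hf.analyticAt (isOpen_ball.mem_nhds ha)
  obtain ⟨n, g, hg, hga, hfg⟩ := han.exists_eventuallyEq_pow_smul_nonzero_iff.2 hne
  have hfa := hfg.self_of_nhds
  refine ⟨n, Function.update (fun t => f t / (t - a) ^ n) a (g a), fun t ht => ?_, by simpa, ?_⟩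
  · refine DifferentiableAt.differentiableWithinAt ?_
    by_cases h : t = a
    · subst h
      refine hg.differentiableAt.congr_of_eventuallyEq ?_
      filter_upwards [hfg] with s hs
      by_cases hst : s = t
      · subst hst; simp
      · rw [Function.update_of_ne hst, hs, smul_eq_mul,
          mul_div_cancel_left₀ _ (pow_ne_zero _ (sub_ne_zero.2 hst))]
    · have h1 : DifferentiableAt ℂ (fun t => f t / (t - a) ^ n) t :=
        (hf.differentiableAt (isOpen_ball.mem_nhds ht)).div (by fun_prop)
          (pow_ne_zero _ (sub_ne_zero.2 h))
      refine h1.congr_of_eventuallyEq ?_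
      filter_upwards [isOpen_ne.mem_nhds h] with s hs
      rw [Function.update_of_ne hs]
  · intro t
    by_cases h : t = a
    · subst h; simpa using hfa
    · rw [Function.update_of_ne h, mul_div_cancel₀ _ (pow_ne_zero _ (sub_ne_zero.2 h))]

/-- The argument principle on a disc, weighted by a holomorphic function. -/
theorem exists_multiset_circleIntegral_logDeriv {f : ℂ → ℂ} {r R : ℝ} (hr : 0 < r) (hrR : r < R)
    (hf : DifferentiableOn ℂ f (ball 0 R)) (hne : ∀ t ∈ sphere (0 : ℂ) r, f t ≠ 0) :
    ∃ s : Multiset ℂ, (∀ t, t ∈ s ↔ t ∈ ball (0 : ℂ) r ∧ f t = 0) ∧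
      ∀ φ : ℂ → ℂ, DifferentiableOn ℂ φ (ball 0 R) →
        ∮ t in C(0, r), φ t * (deriv f t / f t) = (2 * Real.pi * Complex.I) * (s.map φ).sum := by
  have hsub : closedBall (0 : ℂ) r ⊆ ball 0 R := closedBall_subset_ball hrR
  have hloc : ∀ {h : ℂ → ℂ}, DifferentiableOn ℂ h (ball 0 R) →
      (∀ t ∈ sphere (0 : ℂ) r, h t ≠ 0) → ∀ a ∈ ball (0 : ℂ) R, ¬ ∀ᶠ t in 𝓝 a, h t = 0 := by
    intro h hh hhne a ha hz
    have han : AnalyticOnNhd ℂ h (ball 0 R) := hh.analyticOnNhd isOpen_ball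
    have h0 := han.eqOn_zero_of_preconnected_of_eventuallyEq_zero
      (convex_ball (0 : ℂ) R).isPreconnected ha hz
    have hrs : (r : ℂ) ∈ sphere (0 : ℂ) r := by simp [abs_of_pos hr]
    exact hhne _ hrs (h0 (hsub (sphere_subset_closedBall hrs)))
  have hfin : {t ∈ closedBall (0 : ℂ) r | f t = 0}.Finite := by
    by_contra hinf
    obtain ⟨a, ha, hacc⟩ := Set.Infinite.exists_accPt_of_subset_isCompact hinf
      (isCompact_closedBall (0 : ℂ) r) (sep_subset _ _)
    have han : AnalyticAt ℂ f a := hf.analyticAt (isOpen_ball.mem_nhds (hsub ha))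
    refine hloc hf hne a (hsub ha) (han.frequently_zero_iff_eventually_zero.1 ?_)
    exact (accPt_iff_frequently_nhdsNE.1 hacc).mono fun t ht => ht.2
  obtain ⟨T, hT⟩ : ∃ T : Finset ℂ, ∀ t ∈ closedBall (0 : ℂ) r, f t = 0 → t ∈ T :=
    ⟨hfin.toFinset, fun t ht h0 => by simp_all⟩
  clear hfin
  induction T using Finset.induction_on generalizing f with
  | empty =>
    have hz : ∀ t ∈ closedBall (0 : ℂ) r, f t ≠ 0 := fun t ht h => by simpa using hT t ht h
    refine ⟨0, fun t => ?_, fun φ hφ => ?_⟩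
    · simp only [Multiset.notMem_zero, false_iff, not_and]
      exact fun ht => hz t (ball_subset_closedBall ht)
    · simp only [Multiset.map_zero, Multiset.sum_zero, mul_zero]
      have hdd : DifferentiableOn ℂ (fun t => φ t * (deriv f t / f t)) (closedBall 0 r) :=
        (hφ.mono hsub).mul (((hf.deriv isOpen_ball).mono hsub).div (hf.mono hsub) hz)
      exact Complex.circleIntegral_eq_zero_of_differentiable_on_off_countable hr.le
        countable_empty hdd.continuousOn fun z hz' =>
          hdd.differentiableAt (closedBall_mem_nhds_of_mem hz'.1)
  | insert a T haT ih =>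
    by_cases haz : a ∈ closedBall (0 : ℂ) r ∧ f a = 0
    · obtain ⟨ha, hfa⟩ := haz
      have haB : a ∈ ball (0 : ℂ) r := by
        rcases (mem_closedBall_zero_iff.1 ha).lt_or_eq with h | h
        · simpa using h
        · exact absurd hfa (hne a (by simpa using h))
      obtain ⟨n, u, hu, hua, hfu⟩ := exists_eq_pow_mul_of_differentiableOn (hsub ha) hf
        (hloc hf hne a (hsub ha))
      have hfu' : f = fun t => (t - a) ^ n * u t := funext hfu
      have hn : n ≠ 0 := by
        rintro rfl
        exact hua (by simpa [hfa] using (hfu a).symm)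
      have hune : ∀ t ∈ sphere (0 : ℂ) r, u t ≠ 0 := fun t ht h => hne t ht (by simp [hfu, h])
      obtain ⟨s, hs, hint⟩ := ih hu hune fun t ht h => by
        have h1 := hT t ht (by simp [hfu, h])
        rcases Finset.mem_insert.1 h1 with rfl | h2
        · exact absurd h hua
        · exact h2
      refine ⟨Multiset.replicate n a + s, fun t => ?_, fun φ hφ => ?_⟩
      · rw [Multiset.mem_add, Multiset.mem_replicate, hs, hfu, mul_eq_zero, pow_eq_zero_iff hn,
          sub_eq_zero]
        constructor
        · rintro (⟨-, rfl⟩ | h)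
          · exact ⟨haB, Or.inl rfl⟩
          · exact ⟨h.1, Or.inr h.2⟩
        · rintro ⟨h1, h2 | h2⟩
          · exact Or.inl ⟨hn, h2⟩
          · exact Or.inr ⟨h1, h2⟩
      · have hsp : ∀ t ∈ sphere (0 : ℂ) r, t - a ≠ 0 := fun t ht h => by
          rw [sub_eq_zero] at h
          subst h
          exact hne t ht hfa
        have hcφ : ContinuousOn φ (sphere 0 r) :=
          hφ.continuousOn.mono (sphere_subset_closedBall.trans hsub)
        have hcu : ContinuousOn u (sphere 0 r) :=
          hu.continuousOn.mono (sphere_subset_closedBall.trans hsub)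
        have hcdu : ContinuousOn (deriv u) (sphere 0 r) :=
          (hu.deriv isOpen_ball).continuousOn.mono (sphere_subset_closedBall.trans hsub)
        have heq : EqOn (fun t => φ t * (deriv f t / f t))
            (fun t => (n : ℂ) * ((t - a)⁻¹ • φ t) + φ t * (deriv u t / u t)) (sphere 0 r) := by
          intro t ht
          have hut : DifferentiableAt ℂ u t := hu.differentiableAt
            (isOpen_ball.mem_nhds (hsub (sphere_subset_closedBall ht)))
          have h1 : logDeriv f t = n / (t - a) + logDeriv u t := by
            rw [hfu', logDeriv_mul (f := fun t => (t - a) ^ n) t (pow_ne_zero _ (hsp t ht))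
              (hune t ht) (by fun_prop) hut, logDeriv_fun_pow (by fun_prop)]
            simp [logDeriv_apply, div_eq_mul_inv]
          rw [logDeriv_apply, logDeriv_apply] at h1
          simp only [h1, smul_eq_mul]
          ring
        rw [circleIntegral.integral_congr hr.le heq, circleIntegral.integral_add,
          circleIntegral.integral_const_mul, hint φ hφ,
          (hφ.mono hsub).circleIntegral_sub_inv_smul haB]
        · simp only [smul_eq_mul, Multiset.map_add, Multiset.map_replicate, Multiset.sum_add,
            Multiset.sum_replicate, nsmul_eq_mul]
          ring
        · refine ContinuousOn.circleIntegrable hr.le ?_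
          refine continuousOn_const.mul (ContinuousOn.smul (ContinuousOn.inv₀ (by fun_prop) hsp) hcφ)
        · exact ContinuousOn.circleIntegrable hr.le (hcφ.mul (hcdu.div hcu hune))
    · refine ih hf hne fun t ht h => ?_
      rcases Finset.mem_insert.1 (hT t ht h) with rfl | h2
      · exact absurd ⟨ht, h⟩ haz
      · exact h2

theorem exists_lineHol_fiber_prod {W : Type*} [NormedAddCommGroup W] [NormedSpace ℂ W]
    {f : W × ℂ → ℂ} {V : Set W} (hV : IsOpen V) (hVc : IsPreconnected V) {r R : ℝ} (hr : 0 < r)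
    (hrR : r < R) (hf : LineHol f (V ×ˢ ball 0 R))
    (hne : ∀ w ∈ V, ∀ t ∈ sphere (0 : ℂ) r, f (w, t) ≠ 0) :
    ∃ (n : ℕ) (τ : W → Fin n → ℂ),
      (∀ w ∈ V, ∀ t, (∃ j, τ w j = t) ↔ t ∈ ball (0 : ℂ) r ∧ f (w, t) = 0) ∧
      ∀ g : W × ℂ → ℂ, LineHol g (V ×ˢ ball 0 R) → LineHol (fun w => ∏ j, g (w, τ w j)) V := by
  have hslice : ∀ {g : W × ℂ → ℂ}, LineHol g (V ×ˢ ball 0 R) → ∀ w ∈ V,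
      DifferentiableOn ℂ (fun t => g (w, t)) (ball 0 R) := by
    intro g hg w hw
    have h := hg.differentiableOn_line (w, 0) (0, 1)
    simp only [Prod.smul_mk, smul_zero, smul_eq_mul, mul_one, Prod.mk_add_mk, add_zero,
      zero_add] at h
    exact h.mono fun t ht => ⟨hw, ht⟩
  have hroots : ∀ w, ∃ s : Multiset ℂ, w ∈ V → (∀ t, t ∈ s ↔ t ∈ ball (0 : ℂ) r ∧ f (w, t) = 0) ∧
      ∀ φ : ℂ → ℂ, DifferentiableOn ℂ φ (ball 0 R) →
        ∮ t in C(0, r), φ t * (deriv (fun t => f (w, t)) t / f (w, t)) =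
          (2 * Real.pi * Complex.I) * (s.map φ).sum := by
    intro w
    by_cases hw : w ∈ V
    · obtain ⟨s, hs⟩ := exists_multiset_circleIntegral_logDeriv hr hrR (hslice hf w hw) (hne w hw)
      exact ⟨s, fun _ => hs⟩
    · exact ⟨0, fun h => absurd h hw⟩
  choose s hs using hroots
  have hpi : (2 * Real.pi * Complex.I : ℂ) ≠ 0 := Complex.two_pi_I_ne_zero
  have hsum : ∀ g : W × ℂ → ℂ, LineHol g (V ×ˢ ball 0 R) →
      LineHol (fun w => ((s w).map fun t => g (w, t)).sum) V := by
    intro g hg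
    obtain ⟨r', hr', hr'R⟩ := exists_between hrR
    have hsub' : V ×ˢ sphere (0 : ℂ) r ⊆ V ×ˢ ball 0 r' := prod_mono le_rfl
      (sphere_subset_closedBall.trans (closedBall_subset_ball hr'))
    have hsub : V ×ˢ sphere (0 : ℂ) r ⊆ V ×ˢ ball 0 R := prod_mono le_rfl
      (sphere_subset_closedBall.trans (closedBall_subset_ball hrR))
    have hdf := hf.deriv_snd hV hr'R
    have hfne : ∀ p ∈ V ×ˢ sphere (0 : ℂ) r, f p ≠ 0 := fun p hp => hne p.1 hp.1 p.2 hp.2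
    have hcont : ContinuousOn (Function.uncurry fun (w : W) (t : ℂ) =>
        g (w, t) * (deriv (fun t => f (w, t)) t / f (w, t))) (V ×ˢ sphere 0 r) :=
      (hg.1.mono hsub).mul ((hdf.1.mono hsub').div (hf.1.mono hsub) hfne)
    have hlift : ∀ {h : W × ℂ → ℂ} {ρ : ℝ}, LineHol h (V ×ˢ ball 0 ρ) → ∀ t ∈ ball (0 : ℂ) ρ,
        LineHol (fun w => h (w, t)) V := by
      intro h ρ hh t ht
      have := hh.comp_affine (V' := V) (ContinuousLinearMap.inl ℂ W ℂ) (0, t) fun w hw => by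
        exact ⟨by simpa using hw, by simpa using ht⟩
      simpa using this
    have hline : ∀ t ∈ sphere (0 : ℂ) r,
        LineHol (fun w => g (w, t) * (deriv (fun t => f (w, t)) t / f (w, t))) V := by
      intro t ht
      have htR : t ∈ ball (0 : ℂ) R := closedBall_subset_ball hrR (sphere_subset_closedBall ht)
      have htr : t ∈ ball (0 : ℂ) r' := closedBall_subset_ball hr' (sphere_subset_closedBall ht)
      have hft := hlift hf t htR
      refine (hlift hg t htR).mul ⟨((hlift hdf t htr).1).div hft.1 fun w hw => hne w hw t ht,
        fun w hw v => ?_⟩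
      refine ((hlift hdf t htr).2 w hw v).fun_div (hft.2 w hw v) ?_
      simpa using hne w hw t ht
    refine ((LineHol.const (2 * Real.pi * Complex.I : ℂ)⁻¹).mul
      (LineHol.circleIntegral hV hr.le hcont hline)).congr hV fun w hw => ?_
    rw [(hs w hw).2 _ (hslice hg w hw), inv_mul_cancel_left₀ hpi]
  obtain ⟨n, hn⟩ : ∃ n, ∀ w ∈ V, (s w).card = n := by
    rcases V.eq_empty_or_nonempty with rfl | ⟨w₀, hw₀⟩
    · exact ⟨0, fun w hw => absurd hw (notMem_empty w)⟩
    · refine ⟨(s w₀).card, fun w hw => hVc.constant (f := fun w => (s w).card) ?_ hw hw₀⟩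
      have h1 := (hsum (fun _ => 1) (LineHol.const 1)).1
      simp only [Multiset.map_const', Multiset.sum_replicate, nsmul_eq_mul, mul_one] at h1
      have h2 : ContinuousOn (fun w => ((s w).card : ℝ)) V := by
        simpa [Function.comp_def] using Complex.continuous_re.comp_continuousOn h1
      exact Nat.isClosedEmbedding_coe_real.isInducing.continuousOn_iff.2 h2
  have henum : ∀ w, ∃ τ : Fin n → ℂ, w ∈ V → Multiset.map τ Finset.univ.val = s w := by
    intro w
    by_cases hw : w ∈ V
    · obtain ⟨l, hl⟩ := Quot.exists_rep (s w)
      have hlen : l.length = n := by rw [← hn w hw, ← hl]; rfl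
      subst hlen
      exact ⟨l.get, fun _ => by rw [Fin.univ_val_map, List.ofFn_get, ← hl]; rfl⟩
    · exact ⟨0, fun h => absurd h hw⟩
  choose τ hτ using henum
  refine ⟨n, τ, fun w hw t => ?_, fun g hg => ?_⟩
  · rw [← (hs w hw).1, ← hτ w hw]
    simp
  · have hpow : ∀ k, LineHol (fun w => ∑ j, g (w, τ w j) ^ k) V := fun k =>
      (hsum _ (hg.pow k)).congr hV fun w hw => by
        rw [← hτ w hw, Multiset.map_map]; rfl
    have hes : ∀ k, LineHol (fun w => MvPolynomial.aeval (fun j => g (w, τ w j))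
        (MvPolynomial.esymm (Fin n) ℂ k)) V := by
      intro k
      induction k using Nat.strong_induction_on with
      | _ k ih =>
        rcases Nat.eq_zero_or_pos k with rfl | hk
        · simpa using LineHol.const (E := W) (U := V) (1 : ℂ)
        · have hN : LineHol (fun w => (k : ℂ)⁻¹ * ((-1) ^ (k + 1) *
              ∑ a ∈ Finset.HasAntidiagonal.antidiagonal k with a.1 < k,
                (-1) ^ a.1 * MvPolynomial.aeval (fun j => g (w, τ w j))
                  (MvPolynomial.esymm (Fin n) ℂ a.1) * ∑ j, g (w, τ w j) ^ a.2)) V := by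
            refine (LineHol.const _).mul ((LineHol.const _).mul (LineHol.sum _ fun a ha => ?_))
            exact ((LineHol.const _).mul (ih a.1 (Finset.mem_filter.1 ha).2)).mul (hpow a.2)
          refine hN.congr hV fun w _ => ?_
          have hk0 : (k : ℂ) ≠ 0 := Nat.cast_ne_zero.2 hk.ne'
          have h := congrArg (MvPolynomial.aeval fun j => g (w, τ w j))
            (MvPolynomial.mul_esymm_eq_sum (Fin n) ℂ k)
          simp only [map_mul, map_natCast, map_pow, map_neg, map_one, map_sum,
            MvPolynomial.psum, MvPolynomial.aeval_X] at h
          rw [← h, inv_mul_cancel_left₀ hk0]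
    refine (hes n).congr hV fun w _ => ?_
    have hcard : Finset.powersetCard n (Finset.univ : Finset (Fin n)) = {Finset.univ} := by
      simpa using Finset.powersetCard_self (Finset.univ : Finset (Fin n))
    simp [MvPolynomial.esymm, hcard]

theorem Submodule.exists_mem_forall_apply_ne_zero {X ι : Type*} [Fintype ι]
    (S : Submodule ℂ (X → ℂ)) (x : ι → X) (h : ∀ i, ∃ g ∈ S, g (x i) ≠ 0) :
    ∃ g ∈ S, ∀ i, g (x i) ≠ 0 := by
  classical
  let p : ι → Submodule ℂ S := fun i =>
    LinearMap.ker ((LinearMap.proj (R := ℂ) (φ := fun _ : X => ℂ) (x i)).comp S.subtype)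
  have hp : ∀ i, ∀ g : S, g ∈ p i ↔ g.1 (x i) = 0 := fun i g => by simp [p]
  have htop : (⊤ : Submodule ℂ S) ∉ Finset.univ.image p := by
    intro hmem
    obtain ⟨i, -, hi⟩ := Finset.mem_image.1 hmem
    obtain ⟨g, hgS, hg⟩ := h i
    exact hg ((hp i ⟨g, hgS⟩).1 (hi ▸ Submodule.mem_top))
  obtain ⟨g, hg⟩ := (Set.ne_univ_iff_exists_notMem _).1 (Subspace.biUnion_ne_univ_of_top_notMem htop)
  refine ⟨g.1, g.2, fun i hi => hg ?_⟩
  simp only [Finset.mem_image, Finset.mem_univ, true_and, mem_iUnion, SetLike.mem_coe]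
  exact ⟨p i, ⟨i, rfl⟩, (hp i g).2 hi⟩

theorem LineHol.forall_zero_or_exists_ne_zero {U : Set E} (hU : IsOpen U) (h0 : (0 : E) ∈ U)
    {F : Set (E → ℂ)} (hF : ∀ f ∈ F, LineHol f U) (v : E) :
    (∀ᶠ s : ℂ in 𝓝 0, s • v ∈ U ∧ ∀ f ∈ F, f (s • v) = 0) ∨
      ∃ f ∈ F, ∀ᶠ s : ℂ in 𝓝[≠] 0, f (s • v) ≠ 0 := by
  have hcont : Continuous fun s : ℂ => s • v := by fun_prop
  obtain ⟨ρ, hρ, hsub⟩ := Metric.mem_nhds_iff.1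
    (hcont.continuousAt.preimage_mem_nhds (hU.mem_nhds (show (0 : ℂ) • v ∈ U by simpa)))
  have han : ∀ f ∈ F, AnalyticOnNhd ℂ (fun s : ℂ => f (s • v)) (ball 0 ρ) := fun f hf => by
    refine DifferentiableOn.analyticOnNhd ?_ isOpen_ball
    have h := (hF f hf).differentiableOn_line 0 v
    simp only [zero_add] at h
    exact h.mono hsub
  by_cases h : ∀ f ∈ F, ∀ᶠ s : ℂ in 𝓝 0, f (s • v) = 0
  · left
    filter_upwards [ball_mem_nhds (0 : ℂ) hρ] with s hs
    exact ⟨hsub hs, fun f hf => (han f hf).eqOn_zero_of_preconnected_of_eventuallyEq_zero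
      (convex_ball (0 : ℂ) ρ).isPreconnected (mem_ball_self hρ) (h f hf) hs⟩
  · right
    push Not at h
    obtain ⟨f, hf, hne⟩ := h
    refine ⟨f, hf, ?_⟩
    exact ((han f hf) 0 (mem_ball_self hρ)).eventually_eq_zero_or_eventually_ne_zero.resolve_left
      fun h => hne (h.mono fun _ hx hx' => hx' hx)

/-- Let `0` be isolated in the intersection of an analytic set with the kernel of a linear
functional. Then the image of the germ of the set under the functional is either a neighbourhood
of `0` or reduced to `0`. -/
theorem image_zeroSet_mem_nhds_or_subset_zero (n : ℕ) : ∀ (E : Type u) [NormedAddCommGroup E]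
    [NormedSpace ℂ E] [FiniteDimensional ℂ E], Module.finrank ℂ E = n → ∀ (U : Set E),
    IsOpen U → (0 : E) ∈ U → ∀ (F : Set (E → ℂ)), (∀ f ∈ F, LineHol f U) → (∀ f ∈ F, f 0 = 0) →
    ∀ l : E →L[ℂ] ℂ, (∀ᶠ x in 𝓝 (0 : E), x ∈ U → (∀ f ∈ F, f x = 0) → l x = 0 → x = 0) →
    (∀ N ∈ 𝓝 (0 : E), l '' {x | x ∈ N ∧ x ∈ U ∧ ∀ f ∈ F, f x = 0} ∈ 𝓝 0) ∨
      ∀ᶠ x in 𝓝 (0 : E), x ∈ U → (∀ f ∈ F, f x = 0) → l x = 0 := by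
  induction n with
  | zero =>
    intro E _ _ _ hn U _ _ F _ _ l _
    have := Module.finrank_zero_iff.1 hn
    exact Or.inr (Eventually.of_forall fun x _ _ => by rw [Subsingleton.elim x 0, map_zero])
  | succ n ih =>
  intro E _ _ _ hn U hU h0U F hF hF0 l hiso
  by_cases hker : ∀ x, l x = 0 → x = 0
  · by_cases hl : ∀ x, l x = 0
    · exact Or.inr (Eventually.of_forall fun x _ _ => hl x)
    obtain ⟨x₀, hx₀⟩ := not_forall.1 hl
    obtain ⟨e, he⟩ : ∃ e, l e = 1 := ⟨(l x₀)⁻¹ • x₀, by simp [hx₀]⟩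
    have hx : ∀ x, x = l x • e := fun x => sub_eq_zero.1 (hker _ (by simp [he]))
    rcases LineHol.forall_zero_or_exists_ne_zero hU h0U hF e with h | ⟨f, hf, h⟩
    · left
      intro N hN
      have hcont : Continuous fun s : ℂ => s • e := by fun_prop
      have hN' : ∀ᶠ s : ℂ in 𝓝 0, s • e ∈ N :=
        hcont.continuousAt.eventually (show N ∈ 𝓝 ((0 : ℂ) • e) by simpa)
      filter_upwards [h, hN'] with s hs hsN
      exact ⟨s • e, ⟨hsN, hs⟩, by simp [he]⟩
    · right
      have h1 := eventually_nhdsWithin_iff.1 h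
      have h2 : ∀ᶠ x in 𝓝 (0 : E), l x ∈ ({0}ᶜ : Set ℂ) → f (l x • e) ≠ 0 :=
        l.continuous.continuousAt.eventually
          (show ∀ᶠ s in 𝓝 (l 0), s ∈ ({0}ᶜ : Set ℂ) → f (s • e) ≠ 0 by rw [map_zero]; exact h1)
      filter_upwards [h2] with x hx' _ hz
      by_contra hne
      exact hx' hne (by rw [← hx]; exact hz f hf)
  push Not at hker
  obtain ⟨v, hlv, hv⟩ := hker
  rcases LineHol.forall_zero_or_exists_ne_zero hU h0U hF v with h | ⟨f, hf, hfv⟩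
  · exfalso
    have hcont : Continuous fun s : ℂ => s • v := by fun_prop
    have h1 : ∀ᶠ s : ℂ in 𝓝 0, s • v ∈ U → (∀ f ∈ F, f (s • v) = 0) → l (s • v) = 0 → s • v = 0 :=
      hcont.continuousAt.eventually (show ∀ᶠ x in 𝓝 ((0 : ℂ) • v), x ∈ U → (∀ f ∈ F, f x = 0) →
        l x = 0 → x = 0 by rw [zero_smul]; exact hiso)
    obtain ⟨s, ⟨hs1, hs2⟩, hs3⟩ := (((h1.and h).filter_mono nhdsWithin_le_nhds).and
      (self_mem_nhdsWithin (s := ({0}ᶜ : Set ℂ)))).exists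
    exact (smul_ne_zero hs3 hv) (hs1 hs2.1 hs2.2 (by simp [hlv]))
  obtain ⟨μ, hμ⟩ := SeparatingDual.exists_eq_one (R := ℂ) hv
  let W : Submodule ℂ E := LinearMap.ker (μ : E →ₗ[ℂ] ℂ)
  let L : W × ℂ →L[ℂ] E := W.subtypeL.coprod (ContinuousLinearMap.toSpanSingleton ℂ v)
  have hL : ∀ w t, L (w, t) = w + t • v := fun w t => by simp [L]
  let P : E →L[ℂ] W := (ContinuousLinearMap.id ℂ E - μ.smulRight v).codRestrict W fun x => by
    simp [W, hμ]
  have hLP : ∀ x, L (P x, μ x) = x := fun x => by simp [hL, P]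
  have hμL : ∀ w t, μ (L (w, t)) = t := fun w t => by
    have : μ (w : E) = 0 := w.2
    simp [hL, this, hμ]
  have hlL : ∀ w t, l (L (w, t)) = l w := fun w t => by simp [hL, hlv]
  have hfr : Module.finrank ℂ W = n := by
    have h1 := LinearMap.finrank_range_add_finrank_ker (μ : E →ₗ[ℂ] ℂ)
    have h2 : LinearMap.range (μ : E →ₗ[ℂ] ℂ) = ⊤ := LinearMap.range_eq_top.2 fun c =>
      ⟨c • v, by simp [hμ]⟩
    rw [h2, finrank_top, Module.finrank_self, hn] at h1
    change 1 + Module.finrank ℂ W = _ at h1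
    omega
  have hL0 : L 0 = 0 := map_zero L
  obtain ⟨ρ₀, hρ₀, hρ₀U⟩ : ∃ ρ > 0, ball (0 : W) ρ ×ˢ ball (0 : ℂ) ρ ⊆ L ⁻¹' U := by
    obtain ⟨ρ, hρ, h⟩ := Metric.mem_nhds_iff.1 (L.continuous.continuousAt.preimage_mem_nhds
      (hU.mem_nhds (show L 0 ∈ U by rwa [hL0])))
    exact ⟨ρ, hρ, by rwa [ball_prod_same]⟩
  obtain ⟨ρ₁, hρ₁, hρ₁f⟩ : ∃ ρ > 0, ∀ t ∈ ball (0 : ℂ) ρ, t ≠ 0 → f (t • v) ≠ 0 :=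
    Metric.eventually_nhds_iff_ball.1 (eventually_nhdsWithin_iff.1 hfv)
  set R := min ρ₀ ρ₁ with hR
  have hR0 : 0 < R := lt_min hρ₀ hρ₁
  set r := R / 2 with hr
  have hr0 : 0 < r := by positivity
  have hrR : r < R := by rw [hr]; linarith
  have hlin : ∀ g, LineHol g U →
      LineHol (fun p => g (L p)) (ball (0 : W) ρ₀ ×ˢ ball (0 : ℂ) R) := fun g hg => by
    simpa using hg.comp_affine (V' := ball (0 : W) ρ₀ ×ˢ ball (0 : ℂ) R) L 0 fun p hp => by
      simpa using hρ₀U (prod_mono le_rfl (ball_subset_ball (min_le_left _ _)) hp)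
  have htube : ∀ r' > 0, ∀ᶠ w in 𝓝 (0 : W), ∀ t ∈ closedBall (0 : ℂ) r \ ball 0 r',
      f (L (w, t)) ≠ 0 := by
    intro r' hr'
    refine ((isCompact_closedBall (0 : ℂ) r).diff isOpen_ball).eventually_forall_of_forall_eventually
      fun t ht => ?_
    have htR : t ∈ ball (0 : ℂ) R := closedBall_subset_ball hrR ht.1
    have hmem : ((0 : W), t) ∈ ball (0 : W) ρ₀ ×ˢ ball (0 : ℂ) R := ⟨mem_ball_self hρ₀, htR⟩
    have hca := (hlin f (hF f hf)).1.continuousAt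
      ((isOpen_ball.prod isOpen_ball).mem_nhds hmem)
    refine hca.eventually_ne ?_
    rw [hL]
    simp only [ZeroMemClass.coe_zero, zero_add]
    refine hρ₁f t (ball_subset_ball (min_le_right _ _) htR) ?_
    rintro rfl
    exact ht.2 (mem_ball_self hr')
  obtain ⟨ρ₂, hρ₂, hρ₂f⟩ := Metric.eventually_nhds_iff_ball.1 (htube r hr0)
  set V : Set W := ball 0 (min ρ₀ ρ₂) with hV
  have hVo : IsOpen V := isOpen_ball
  have h0V : (0 : W) ∈ V := mem_ball_self (lt_min hρ₀ hρ₂)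
  have hVR : V ×ˢ ball (0 : ℂ) R ⊆ ball (0 : W) ρ₀ ×ˢ ball (0 : ℂ) R :=
    prod_mono (ball_subset_ball (min_le_left _ _)) le_rfl
  have hVU : ∀ w ∈ V, ∀ t ∈ ball (0 : ℂ) R, L (w, t) ∈ U := fun w hw t ht =>
    hρ₀U ⟨ball_subset_ball (min_le_left _ _) hw, ball_subset_ball (min_le_left _ _) ht⟩
  have hrR' : ball (0 : ℂ) r ⊆ ball 0 R := ball_subset_ball hrR.le
  obtain ⟨m, τ, hτ, hprod⟩ := exists_lineHol_fiber_prod hVo (convex_ball _ _).isPreconnected hr0 hrR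
    ((hlin f (hF f hf)).mono hVR) fun w hw t ht =>
      hρ₂f w (ball_subset_ball (min_le_right _ _) hw) t
        ⟨sphere_subset_closedBall ht, fun h => by
          rw [mem_ball, mem_sphere.1 ht] at h; exact lt_irrefl _ h⟩
  have hspan : ∀ g ∈ Submodule.span ℂ F, LineHol g U := fun g hg => by
    induction hg using Submodule.span_induction with
    | mem g hg => exact hF g hg
    | zero => exact LineHol.const 0
    | add g h _ _ hg hh => exact hg.add hh
    | smul c g _ hg => exact (LineHol.const c).mul hg
  have hspan0 : ∀ x, (∀ g ∈ F, g x = 0) → ∀ g ∈ Submodule.span ℂ F, g x = 0 := fun x hx g hg => by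
    induction hg using Submodule.span_induction with
    | mem g hg => exact hx g hg
    | zero => rfl
    | add g h _ _ hg hh => simp [hg, hh]
    | smul c g _ hg => simp [hg]
  let F' : Set (W → ℂ) := {h | ∃ g ∈ Submodule.span ℂ F, h = fun w => ∏ j, g (L (w, τ w j))}
  have hF' : ∀ w ∈ V, (∀ h ∈ F', h w = 0) ↔ ∃ t ∈ ball (0 : ℂ) r, ∀ g ∈ F, g (L (w, t)) = 0 := by
    intro w hw
    constructor
    · intro h
      by_contra! hcon
      obtain ⟨g, hg, hgne⟩ := Submodule.exists_mem_forall_apply_ne_zero (Submodule.span ℂ F)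
        (fun j => L (w, τ w j)) fun j => by
          obtain ⟨g, hg, hne⟩ := hcon (τ w j) ((hτ w hw _).1 ⟨j, rfl⟩).1
          exact ⟨g, Submodule.subset_span hg, hne⟩
      exact Finset.prod_ne_zero_iff.2 (fun j _ => hgne j) (h _ ⟨g, hg, rfl⟩)
    · rintro ⟨t, ht, hz⟩ h ⟨g, hg, rfl⟩
      obtain ⟨j, rfl⟩ := (hτ w hw t).2 ⟨ht, hz f hf⟩
      exact Finset.prod_eq_zero (Finset.mem_univ j) (hspan0 _ hz g hg)
  have hsmall : ∀ N ∈ 𝓝 (0 : E), ∀ᶠ w in 𝓝 (0 : W), ∀ t ∈ ball (0 : ℂ) r,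
      f (L (w, t)) = 0 → L (w, t) ∈ N := by
    intro N hN
    obtain ⟨ρ, hρ, hρN⟩ := Metric.mem_nhds_iff.1 (L.continuous.continuousAt.preimage_mem_nhds
      (show N ∈ 𝓝 (L 0) by rwa [hL0]))
    filter_upwards [htube ρ hρ, ball_mem_nhds (0 : W) hρ] with w hw hwρ t ht hz
    have htρ : t ∈ ball (0 : ℂ) ρ := by
      by_contra hcon
      exact hw t ⟨ball_subset_closedBall ht, hcon⟩ hz
    exact hρN (by rw [show (0 : W × ℂ) = (0, 0) from rfl, ← ball_prod_same]; exact ⟨hwρ, htρ⟩)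
  have hIH := ih W hfr V hVo h0V F' ?_ ?_ (l.comp W.subtypeL) ?_
  · rcases hIH with h | h
    · left
      intro N hN
      refine mem_of_superset (h _ (hsmall N hN)) ?_
      rintro _ ⟨w, ⟨hw1, hwV, hw2⟩, rfl⟩
      obtain ⟨t, ht, hz⟩ := (hF' w hwV).1 hw2
      exact ⟨L (w, t), ⟨hw1 t ht (hz f hf), hVU w hwV t (hrR' ht), hz⟩, hlL w t⟩
    · right
      have h1 : ∀ᶠ x in 𝓝 (0 : E), P x ∈ V ∧ (P x ∈ V → (∀ h ∈ F', h (P x) = 0) →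
          (l.comp W.subtypeL) (P x) = 0) :=
        P.continuous.continuousAt.eventually
          (by rw [map_zero]; exact (hVo.eventually_mem h0V).and h)
      have h2 : ∀ᶠ x in 𝓝 (0 : E), μ x ∈ ball (0 : ℂ) r :=
        μ.continuous.continuousAt.eventually (by rw [map_zero]; exact ball_mem_nhds _ hr0)
      filter_upwards [h1, h2] with x hx1 hx2 _ hz
      have := hx1.2 hx1.1 ((hF' _ hx1.1).2 ⟨μ x, hx2, by rwa [hLP]⟩)
      rw [← hLP x, hlL]
      exact this
  · rintro _ ⟨g, hg, rfl⟩
    exact hprod (fun p => g (L p)) ((hlin g (hspan g hg)).mono hVR)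
  · refine (hF' 0 h0V).2 ⟨0, mem_ball_self hr0, fun g hg => ?_⟩
    rw [show L (0, 0) = 0 from hL0]
    exact hF0 g hg
  · filter_upwards [hsmall _ hiso] with w hw hwV hz hlw
    obtain ⟨t, ht, hz'⟩ := (hF' w hwV).1 hz
    have h0 : L (w, t) = 0 := hw t ht (hz' f hf) (hVU w hwV t (hrR' ht)) hz' (by rw [hlL]; exact hlw)
    have ht0 : t = 0 := by rw [← hμL w t, h0, map_zero]
    subst ht0
    have := hL w 0
    rw [h0] at this
    exact Subtype.ext (by simpa using this.symm)

theorem Differentiable.lineHol {f : E → ℂ} (hf : Differentiable ℂ f) (U : Set E) : LineHol f U :=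
  ⟨hf.continuous.continuousOn, fun a _ v =>
    (hf.comp (f := fun s : ℂ => a + s • v) (by fun_prop)).differentiableAt⟩

theorem LineHol.of_uniform_approx {f : E → ℂ} {U : Set E}
    (h : ∀ ε > 0, ∃ g, LineHol g U ∧ ∀ x ∈ U, ‖f x - g x‖ < ε) (hU : IsOpen U) : LineHol f U := by
  choose! g hg hfg using h
  have hε : ∀ n : ℕ, (0 : ℝ) < 1 / ((n : ℝ) + 1) := fun n => Nat.one_div_pos_of_nat
  have hlim : TendstoUniformlyOn (fun n : ℕ => g (1 / ((n : ℝ) + 1))) f atTop U := by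
    rw [Metric.tendstoUniformlyOn_iff]
    intro ε hε'
    filter_upwards [tendsto_one_div_add_atTop_nhds_zero_nat.eventually_lt_const hε'] with n hn x hx
    rw [dist_eq_norm]
    exact (hfg _ (hε n) x hx).trans hn
  refine ⟨hlim.continuousOn (Frequently.of_forall fun n => (hg _ (hε n)).1), fun a ha v => ?_⟩
  have hcont : Continuous fun s : ℂ => a + s • v := by fun_prop
  have hopen : IsOpen {s : ℂ | a + s • v ∈ U} := hU.preimage hcont
  exact ((hlim.comp fun s : ℂ => a + s • v).tendstoLocallyUniformlyOn.differentiableOn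
    (Eventually.of_forall fun n => (hg _ (hε n)).differentiableOn_line a v) hopen).differentiableAt
    (hopen.mem_nhds (by simpa using ha))

theorem not_countable_Ioo_real {a b : ℝ} (h : a < b) : ¬ (Ioo a b).Countable := by
  rw [← Cardinal.le_aleph0_iff_set_countable, Cardinal.mk_Ioo_real h, not_le]
  exact Cardinal.aleph0_lt_continuum

theorem countable_setOf_mul_exp_sum_eq_one {d : ℕ} {v : Fin d → ℂ} (hv : v ≠ 0) {k : ℂ}
    (hk : k ≠ 0) (a : ℂ) :
    {τ : ℝ | a * Complex.exp (k * ∑ i, (τ : ℂ) ^ (i.1 + 1) * v i ^ 2) = 1}.Countable := by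
  by_cases hne : ∃ c, a * Complex.exp c = 1
  swap
  · convert countable_empty (α := ℝ)
    exact eq_empty_of_forall_notMem fun τ hτ => hne ⟨_, hτ⟩
  obtain ⟨c, hc⟩ := hne
  obtain ⟨j, hj⟩ := Function.ne_iff.1 hv
  let P : Polynomial ℂ := ∑ i : Fin d, Polynomial.C (v i ^ 2) * Polynomial.X ^ (i.1 + 1)
  have hP : ∀ b : ℂ, P - Polynomial.C b ≠ 0 := fun b h => by
    have h1 := congrArg (fun p : Polynomial ℂ => p.coeff (j.1 + 1)) h
    simp only [P, Polynomial.coeff_sub, Polynomial.finsetSum_coeff, Polynomial.coeff_C_mul,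
      Polynomial.coeff_X_pow, Polynomial.coeff_C_succ, Polynomial.coeff_zero, add_left_inj,
      Fin.val_inj, sub_zero, mul_ite, mul_one, mul_zero, Finset.sum_ite_eq, Finset.mem_univ,
      if_true] at h1
    exact hj (eq_zero_of_pow_eq_zero h1)
  have hfin : ∀ b : ℂ, {τ : ℝ | (P - Polynomial.C b).IsRoot (τ : ℂ)}.Finite := fun b =>
    (Polynomial.finite_setOfPred_isRoot (hP b)).preimage Complex.ofReal_injective.injOn
  refine (countable_iUnion fun n : ℤ =>
    (hfin ((c + n * (2 * Real.pi * Complex.I)) / k)).countable).mono fun τ hτ => ?_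
  have ha : a ≠ 0 := left_ne_zero_of_mul_eq_one hc
  obtain ⟨n, hn⟩ := Complex.exp_eq_exp_iff_exists_int.1
    (mul_left_cancel₀ ha ((show a * _ = 1 from hτ).trans hc.symm))
  refine mem_iUnion.2 ⟨n, ?_⟩
  rw [← hn, mul_div_cancel_left₀ _ hk]
  simp [P, Polynomial.eval_finsetSum, mul_comm]

theorem exists_differentiable_mul_exp_ne_one {d : ℕ} {V : Set (EuclideanSpace ℂ (Fin d))}
    (hV : V.Countable) (h : EuclideanSpace ℂ (Fin d) → ℂ) {k : ℂ} (hk : k ≠ 0) :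
    ∃ Q : EuclideanSpace ℂ (Fin d) → ℂ, Differentiable ℂ Q ∧ Q 0 = 0 ∧ (∀ v, ‖Q v‖ ≤ ‖v‖ ^ 2) ∧
      ∀ v ∈ V, v ≠ 0 → h v * Complex.exp (k * Q v) ≠ 1 := by
  have hbad : (⋃ v ∈ V \ {0}, {τ : ℝ |
      h v * Complex.exp (k * ∑ i, (τ : ℂ) ^ (i.1 + 1) * v i ^ 2) = 1}).Countable :=
    (hV.mono sdiff_subset).biUnion fun v hv => countable_setOf_mul_exp_sum_eq_one
      (v := fun i => v i) (fun h0 => hv.2 (by ext i; exact congrFun h0 i)) hk _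
  obtain ⟨τ, hτ, hτ'⟩ := not_subset.1 fun hsub =>
    not_countable_Ioo_real zero_lt_one (hbad.mono hsub)
  refine ⟨fun v => ∑ i, (τ : ℂ) ^ (i.1 + 1) * v i ^ 2, by fun_prop, by simp, fun v => ?_,
    fun v hv hv0 h1 => hτ' (mem_biUnion ⟨hv, hv0⟩ h1)⟩
  rw [EuclideanSpace.norm_sq_eq]
  refine (norm_sum_le _ _).trans (Finset.sum_le_sum fun i _ => ?_)
  rw [norm_mul, norm_pow, norm_pow, Complex.norm_real, Real.norm_of_nonneg hτ.1.le]
  exact mul_le_of_le_one_left (by positivity) (pow_le_one₀ hτ.1.le hτ.2.le)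

/-- Peaking functions at suitable accumulation points of a compact subset of the ball. -/
theorem exists_lineHol_peak {d : ℕ} {Z : Set (EuclideanSpace ℂ (Fin d))} (hZ : IsCompact Z)
    (hZ1 : Z ⊆ closedBall 0 1) {φ : EuclideanSpace ℂ (Fin d) → ℂ} (hφ : LineHol φ (ball 0 1))
    (hφc : ContinuousOn φ (closedBall 0 1)) {z : EuclideanSpace ℂ (Fin d)} (hz : AccPt z (𝓟 Z))
    {c : ℝ} (hc : 0 ≤ c) (hcφ : ∀ ζ ∈ Z, ‖ζ‖ = 1 → ‖φ ζ‖ ≤ c) (hcz : c < ‖φ z‖) :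
    ∃ V : Set (EuclideanSpace ℂ (Fin d)), V.Countable ∧ ∃ p ∈ ball (0 : EuclideanSpace ℂ (Fin d)) 1,
      AccPt p (𝓟 Z) ∧ ∃ H : EuclideanSpace ℂ (Fin d) → ℂ, LineHol H (ball 0 1) ∧ H p = 1 ∧
        (∀ w ∈ Z, H w = 1 → w = p) ∧ ∀ w ∈ Z, w ∈ V ∨ ‖H w‖ ≤ 1 := by
  obtain ⟨V, D, hVc, hD, hVD⟩ := exists_countable_union_perfect_of_isClosed hZ.isClosed
  have hZd : derivedSet Z ⊆ Z := (isClosed_iff_derivedSet_subset Z).1 hZ.isClosed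
  set S : Set (EuclideanSpace ℂ (Fin d)) := (Z ∩ sphere 0 1) ∪ derivedSet Z with hS
  have hSZ : S ⊆ Z := union_subset inter_subset_left hZd
  have hSc : IsCompact S := hZ.of_isClosed_subset
    ((hZ.isClosed.inter isClosed_sphere).union (isClosed_derivedSet Z)) hSZ
  have hVS : ∀ w ∈ Z, w ∈ V ∨ w ∈ S := fun w hw => by
    rw [hVD] at hw
    refine hw.imp id fun hwD => Or.inr ?_
    exact (hD.acc w hwD).mono (principal_mono.2 (hVD ▸ subset_union_right))
  obtain ⟨ε, hε, hcε⟩ : ∃ ε > 0, c * Real.exp ε < ‖φ z‖ := by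
    have hcont : Continuous fun ε => c * Real.exp ε := by fun_prop
    have h1 : ∀ᶠ ε in 𝓝[>] (0 : ℝ), c * Real.exp ε < ‖φ z‖ :=
      (hcont.continuousAt.eventually_lt_const (by simpa using hcz)).filter_mono nhdsWithin_le_nhds
    obtain ⟨ε, h2, h3⟩ := (h1.and self_mem_nhdsWithin).exists
    exact ⟨ε, h3, h2⟩
  obtain ⟨p, hpS, hp⟩ := hSc.exists_isMaxOn ⟨z, Or.inr hz⟩
    (f := fun w => ‖φ w‖ * Real.exp (ε * ‖w‖ ^ 2))
    ((hφc.mono (hSZ.trans hZ1)).norm.mul (by fun_prop))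
  have hpz : ‖φ z‖ ≤ ‖φ p‖ * Real.exp (ε * ‖p‖ ^ 2) :=
    (le_mul_of_one_le_right (norm_nonneg _) (Real.one_le_exp (by positivity))).trans
      (hp (Or.inr hz))
  have hp1 : ‖p‖ ≠ 1 := fun h => by
    have := hcφ p (hSZ hpS) h
    rw [h, one_pow, mul_one] at hpz
    nlinarith [Real.exp_pos ε]
  have hφp : φ p ≠ 0 := fun h => by
    rw [h, norm_zero, zero_mul] at hpz
    linarith
  have hpd : AccPt p (𝓟 Z) := hpS.resolve_left fun h => hp1 (by simpa using h.2)
  have hpb : p ∈ ball (0 : EuclideanSpace ℂ (Fin d)) 1 := by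
    have := hZ1 (hSZ hpS)
    rw [mem_closedBall_zero_iff] at this
    rw [mem_ball_zero_iff]
    exact this.lt_of_ne hp1
  let h : EuclideanSpace ℂ (Fin d) → ℂ := fun w =>
    φ w * ((φ p)⁻¹ * Complex.exp (2 * ε * inner ℂ p (w - p)))
  obtain ⟨Q, hQd, hQ0, hQ, hQV⟩ := exists_differentiable_mul_exp_ne_one
    (hVc.image fun w => w - p) (fun v => h (p + v)) (k := (ε / 2 : ℝ)) (by
      exact_mod_cast (by positivity : ε / 2 ≠ 0))
  have hbound : ∀ w ∈ S, ‖h w * Complex.exp ((ε / 2 : ℝ) * Q (w - p))‖ ≤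
      Real.exp (-(ε / 2 * ‖w - p‖ ^ 2)) := by
    intro w hw
    have h1 : ‖φ w‖ * Real.exp (ε * ‖w‖ ^ 2) ≤ ‖φ p‖ * Real.exp (ε * ‖p‖ ^ 2) := hp hw
    have h2 : ‖w‖ ^ 2 = ‖p‖ ^ 2 + 2 * (inner ℂ p (w - p)).re + ‖w - p‖ ^ 2 := by
      have := norm_add_sq (𝕜 := ℂ) p (w - p)
      rwa [add_sub_cancel] at this
    have h3 : (Q (w - p)).re ≤ ‖w - p‖ ^ 2 := (Complex.re_le_norm _).trans (hQ _)
    have h4 : ‖φ w‖ ≤ ‖φ p‖ * Real.exp (ε * ‖p‖ ^ 2 - ε * ‖w‖ ^ 2) := by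
      rw [Real.exp_sub, ← mul_div_assoc, le_div_iff₀ (Real.exp_pos _)]
      exact h1
    have h5 : ‖h w * Complex.exp ((ε / 2 : ℝ) * Q (w - p))‖ = ‖φ w‖ * (‖φ p‖⁻¹ *
        Real.exp (2 * ε * (inner ℂ p (w - p)).re + ε / 2 * (Q (w - p)).re)) := by
      have e1 : (2 * (ε : ℂ) * inner ℂ p (w - p)).re = 2 * ε * (inner ℂ p (w - p)).re := by
        rw [mul_assoc, ← Complex.ofReal_ofNat, Complex.re_ofReal_mul, Complex.re_ofReal_mul,
          mul_assoc]
      simp only [h, norm_mul, norm_inv, Complex.norm_exp, Complex.re_ofReal_mul, e1, Real.exp_add]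
      ring
    rw [h5]
    refine (mul_le_mul_of_nonneg_right h4 (by positivity)).trans ?_
    rw [show ∀ A B : ℝ, ‖φ p‖ * A * (‖φ p‖⁻¹ * B) = (‖φ p‖ * ‖φ p‖⁻¹) * (A * B) by
      intros; ring, mul_inv_cancel₀ (norm_ne_zero_iff.2 hφp), one_mul, ← Real.exp_add]
    refine Real.exp_le_exp.2 ?_
    nlinarith
  refine ⟨V, hVc, p, hpb, hpd, fun w => h w * Complex.exp ((ε / 2 : ℝ) * Q (w - p)), ?_, ?_, ?_, ?_⟩
  · have hd1 : Differentiable ℂ fun w : EuclideanSpace ℂ (Fin d) => inner ℂ p (w - p) :=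
      (innerSL ℂ p).differentiable.comp (differentiable_id.sub_const p)
    refine (hφ.mul (Differentiable.lineHol ?_ _)).mul (Differentiable.lineHol ?_ _)
    · exact ((hd1.const_mul _).cexp).const_mul _
    · exact ((hQd.comp (differentiable_id.sub_const p)).const_mul _).cexp
  · simp [h, hφp, hQ0]
  · intro w hw hw1
    by_contra hne
    have hne' : w - p ≠ 0 := sub_ne_zero.2 hne
    rcases hVS w hw with hwV | hwS
    · exact hQV (w - p) ⟨w, hwV, rfl⟩ hne' (by simpa using hw1)
    · have := hbound w hwS
      rw [show h w * _ = 1 from hw1, norm_one, ← Real.exp_zero, Real.exp_le_exp] at this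
      have : 0 < ε / 2 * ‖w - p‖ ^ 2 := by positivity
      linarith
  · intro w hw
    refine (hVS w hw).imp id fun hwS => (hbound w hwS).trans ?_
    rw [← Real.exp_zero, Real.exp_le_exp]
    have : 0 ≤ ε / 2 * ‖w - p‖ ^ 2 := by positivity
    linarith

/-- Maximum principle on the common zero set of a family of holomorphic functions on the ball. -/
theorem norm_le_of_accPt_zeroSet {d : ℕ} {Z : Set (EuclideanSpace ℂ (Fin d))} (hZ : IsCompact Z)
    (hZ1 : Z ⊆ closedBall 0 1) {F : Set (EuclideanSpace ℂ (Fin d) → ℂ)}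
    (hF : ∀ f ∈ F, LineHol f (ball 0 1)) (hZF : ∀ x ∈ ball 0 1, x ∈ Z ↔ ∀ f ∈ F, f x = 0)
    {φ : EuclideanSpace ℂ (Fin d) → ℂ} (hφ : LineHol φ (ball 0 1))
    (hφc : ContinuousOn φ (closedBall 0 1)) {z : EuclideanSpace ℂ (Fin d)} (hz : AccPt z (𝓟 Z))
    {c : ℝ} (hc : 0 ≤ c) (hcφ : ∀ ζ ∈ Z, ‖ζ‖ = 1 → ‖φ ζ‖ ≤ c) : ‖φ z‖ ≤ c := by
  by_contra! hcz
  obtain ⟨V, hV, p, hp, hpacc, H, hH, hHp, hH1, hHV⟩ :=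
    exists_lineHol_peak hZ hZ1 hφ hφc hz hc hcφ hcz
  have hpZ : p ∈ Z := (isClosed_iff_derivedSet_subset Z).1 hZ.isClosed hpacc
  set r := 1 - ‖p‖ with hr
  have hr0 : 0 < r := by rw [mem_ball_zero_iff] at hp; linarith
  have hpr : ∀ w ∈ ball (0 : EuclideanSpace ℂ (Fin d)) r,
      p + w ∈ ball (0 : EuclideanSpace ℂ (Fin d)) 1 := fun w hw => by
    rw [mem_ball_zero_iff] at hw ⊢
    linarith [norm_add_le p w]
  let U : Set (EuclideanSpace ℂ (Fin d) × ℂ) := ball 0 r ×ˢ univ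
  have hlift : ∀ g, LineHol g (ball 0 1) →
      LineHol (fun x : EuclideanSpace ℂ (Fin d) × ℂ => g (p + x.1)) U := fun g hg =>
    hg.comp_affine (ContinuousLinearMap.fst ℂ _ ℂ) p fun x hx => hpr _ hx.1
  let G : Set (EuclideanSpace ℂ (Fin d) × ℂ → ℂ) :=
    insert (fun x => H (p + x.1) - 1 - x.2) ((fun g x => g (p + x.1)) '' F)
  have hG : ∀ x ∈ U, (∀ g ∈ G, g x = 0) ↔ p + x.1 ∈ Z ∧ H (p + x.1) = 1 + x.2 := fun x hx => by
    rw [hZF _ (hpr _ hx.1)]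
    simp only [G, forall_mem_insert, forall_mem_image, sub_sub, sub_eq_zero]
    exact and_comm
  have key := image_zeroSet_mem_nhds_or_subset_zero _ (EuclideanSpace ℂ (Fin d) × ℂ) rfl U
    (isOpen_ball.prod isOpen_univ) ⟨mem_ball_self hr0, mem_univ _⟩ G ?_ ?_
    (ContinuousLinearMap.snd ℂ _ ℂ) ?_
  · rcases key with h | h
    · obtain ⟨ρ, hρ, hρN⟩ := Metric.mem_nhds_iff.1 (h univ univ_mem)
      refine not_countable_Ioo_real hρ (((hV.image H).preimage
        ((add_right_injective (1 : ℂ)).comp Complex.ofReal_injective)).mono fun t ht => ?_)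
      obtain ⟨x, ⟨-, hxU, hx⟩, hxt⟩ := hρN (show (t : ℂ) ∈ ball 0 ρ by
        rw [mem_ball_zero_iff, Complex.norm_real, Real.norm_of_nonneg ht.1.le]; exact ht.2)
      obtain ⟨hxZ, hxH⟩ := (hG x hxU).1 hx
      replace hxH : H (p + x.1) = 1 + (t : ℂ) := by rw [hxH, ← hxt]; rfl
      refine ⟨p + x.1, (hHV _ hxZ).resolve_right ?_, hxH⟩
      rw [hxH, not_le, ← Complex.ofReal_one, ← Complex.ofReal_add, Complex.norm_real,
        Real.norm_of_nonneg (by linarith [ht.1])]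
      linarith [ht.1]
    · have hHc : ContinuousAt H p := hH.1.continuousAt (isOpen_ball.mem_nhds hp)
      have hcont : ContinuousAt (fun w => (w - p, H w - 1)) p := by fun_prop
      have h1 := hcont.eventually (p := fun x => x ∈ U → (∀ f ∈ G, f x = 0) →
        ContinuousLinearMap.snd ℂ _ ℂ x = 0) (by simp only [sub_self, hHp]; exact h)
      obtain ⟨w, ⟨hwp, hwZ⟩, hw1, hwr⟩ :=
        ((accPt_iff_frequently.1 hpacc).and_eventually (h1.and (ball_mem_nhds p hr0))).exists
      have hwU : (w - p, H w - 1) ∈ U := ⟨by rwa [mem_ball_zero_iff, ← dist_eq_norm], mem_univ _⟩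
      refine hwp (hH1 w hwZ (sub_eq_zero.1 (hw1 hwU ((hG _ hwU).2 ?_))))
      simp [hwZ]
  · rintro g (rfl | ⟨f, hf, rfl⟩)
    · exact ((hlift H hH).sub (.const 1)).sub (differentiable_snd.lineHol U)
    · exact hlift f (hF f hf)
  · refine (hG 0 ⟨mem_ball_self hr0, mem_univ _⟩).2 ?_
    simp [hpZ, hHp]
  · refine Eventually.of_forall fun x hxU hx hx2 => ?_
    obtain ⟨hxZ, hxH⟩ := (hG x hxU).1 hx
    replace hx2 : x.2 = 0 := hx2
    refine Prod.ext ?_ hx2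
    rw [hx2, add_zero] at hxH
    simpa using hH1 _ hxZ hxH

end HolomorphicAlongLines

theorem lineHol_extend_of_mem_ballAlg {d : ℕ} {φ : C(CB d, ℂ)} (hφ : φ ∈ ballAlg d) :
    LineHol (Function.extend Subtype.val φ 0) (ball 0 1) := by
  have hext : ∀ (g : C(CB d, ℂ)) x (hx : x ∈ ball (0 : EuclideanSpace ℂ (Fin d)) 1),
      Function.extend Subtype.val g 0 x = g ⟨x, ball_subset_closedBall hx⟩ := fun g x hx =>
    Subtype.val_injective.extend_apply g 0 ⟨x, ball_subset_closedBall hx⟩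
  refine LineHol.of_uniform_approx (fun ε hε => ?_) isOpen_ball
  obtain ⟨g, hg, hφg⟩ := Metric.mem_closure_iff.1 hφ ε hε
  refine ⟨Function.extend Subtype.val g 0, ?_, fun x hx => ?_⟩
  · change g ∈ Algebra.adjoin ℂ _ at hg
    clear hφg
    induction hg using Algebra.adjoin_induction with
    | mem g hg =>
      obtain ⟨i, rfl⟩ := hg
      exact ((EuclideanSpace.proj (𝕜 := ℂ) i).differentiable.lineHol _).congr isOpen_ball
        fun x hx => hext _ x hx
    | algebraMap c => exact (LineHol.const c).congr isOpen_ball fun x hx => hext _ x hx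
    | add f g _ _ hf hg =>
      exact (hf.add hg).congr isOpen_ball fun x hx => by
        rw [hext _ x hx, hext _ x hx, hext _ x hx]; rfl
    | mul f g _ _ hf hg =>
      exact (hf.mul hg).congr isOpen_ball fun x hx => by
        rw [hext _ x hx, hext _ x hx, hext _ x hx]; rfl
  · rw [hext _ x hx, hext _ x hx, ← dist_eq_norm]
    exact (ContinuousMap.dist_apply_le_dist _).trans_lt hφg

theorem norm_le_of_not_isIsolatedIn {d : ℕ} {X : Set (CB d)} {z : CB d}
    (hz : z ∈ ZS d (IX d X) ∩ openD d) (hiso : ¬ IsIsolatedIn d (ZS d (IX d X) ∩ openD d) z)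
    {φ : C(CB d, ℂ)} (hφ : φ ∈ ballAlg d) {c : ℝ} (hc : 0 ≤ c)
    (h : ∀ ζ ∈ ZS d (IX d X) ∩ sphereD d, ‖φ ζ‖ ≤ c) : ‖φ z‖ ≤ c := by
  have hext : ∀ (g : C(CB d, ℂ)) (x : CB d),
      Function.extend Subtype.val g 0 (x : EuclideanSpace ℂ (Fin d)) = g x := fun g x =>
    Subtype.val_injective.extend_apply g 0 x
  have hZ : IsClosed (ZS d (IX d X)) := by
    have : ZS d (IX d X) = ⋂ φ ∈ IX d X, {w | φ w = 0} := by ext; simp [ZS]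
    rw [this]
    exact isClosed_biInter fun φ _ => isClosed_singleton.preimage φ.continuous
  have key := norm_le_of_accPt_zeroSet (Z := Subtype.val '' ZS d (IX d X))
    (F := (fun g : C(CB d, ℂ) => Function.extend Subtype.val g 0) '' IX d X)
    (φ := Function.extend Subtype.val φ 0) (z := z) (hZ.isCompact.image continuous_subtype_val)
    (by rintro _ ⟨x, -, rfl⟩; exact x.2)
    (by rintro _ ⟨g, hg, rfl⟩; exact lineHol_extend_of_mem_ballAlg hg.1) (fun x hx => ?_)
    (lineHol_extend_of_mem_ballAlg hφ) ?_ ?_ hc ?_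
  · rwa [hext] at key
  · rw [forall_mem_image]
    constructor
    · rintro ⟨y, hy, rfl⟩ g hg
      rw [hext]
      exact hy g hg
    · intro hx0
      refine ⟨⟨x, ball_subset_closedBall hx⟩, fun g hg => ?_, rfl⟩
      rw [← hext]
      exact hx0 hg
  · rw [continuousOn_iff_continuous_domRestrict]
    exact φ.continuous.congr fun x => (hext φ x).symm
  · rw [accPt_iff_frequently]
    intro hev
    refine hiso ⟨hz, ?_⟩
    obtain ⟨U, hU, hUo, hzU⟩ := _root_.eventually_nhds_iff.1 hev
    refine ⟨Subtype.val ⁻¹' U, hUo.preimage continuous_subtype_val, ?_⟩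
    ext w
    constructor
    · rintro ⟨hwU, hw, -⟩
      by_contra hne
      exact hU w hwU ⟨fun h => hne (Subtype.ext h), w, hw, rfl⟩
    · rintro rfl
      exact ⟨hzU, hz⟩
  · rintro _ ⟨ζ, hζ, rfl⟩ h1
    rw [hext]
    exact h ζ ⟨hζ, h1⟩

/-- maximum modulus over the boundary part of `Z(I(X))` at a non-isolated
point of `Z(I(X)) ∩ 𝔹_d`. -/
theorem stmt4 (d : ℕ) (hd : 1 ≤ d) (X : Set (CB d)) (z : CB d)
    (hz : z ∈ ZS d (IX d X) ∩ openD d)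
    (hiso : ¬ IsIsolatedIn d (ZS d (IX d X) ∩ openD d) z) :
    (ZS d (IX d X) ∩ sphereD d).Nonempty ∧
    ∀ φ ∈ ballAlg d, ‖φ z‖ ≤ ⨆ ζ : ↥(ZS d (IX d X) ∩ sphereD d), ‖φ ζ.1‖ := by
  constructor
  · by_contra hempty
    rw [not_nonempty_iff_eq_empty] at hempty
    have h := norm_le_of_not_isIsolatedIn hz hiso (φ := 1) (ballAlgSub d).one_mem le_rfl
      (by simp [hempty])
    simp at h
    linarith
  · intro φ hφ
    refine norm_le_of_not_isIsolatedIn hz hiso hφ (Real.iSup_nonneg fun _ => norm_nonneg _)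
      fun ζ hζ => ?_
    exact le_ciSup (f := fun ζ : ↥(ZS d (IX d X) ∩ sphereD d) => ‖φ ζ.1‖)
      ⟨‖φ‖, by rintro _ ⟨ζ, rfl⟩; exact φ.norm_coe_le_norm ζ.1⟩ ⟨ζ, hζ⟩

end
end

section
/- Let X be a zero set for the ball algebra A(𝔹_d) and let X_0 = X ∩ 𝕊_d. Then the smallest zero set for A(𝔹_d) containing X_0, namely Z(I(X_0)), has no isolated points in the open ball: no point of Z(I(X_0)) ∩ 𝔹_d is isolated in Z(I(X_0)) ∩ 𝔹_d. -/
open MeasureTheory Metric Set Filter Topology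

noncomputable section

theorem exists_sub_sum_mem_of_approx {A : Type*} [NormedCommRing A] [NormedAlgebra ℂ A]
    [CompleteSpace A] {ι : Type*} [Fintype ι] (P : Submodule ℂ A) (hP : IsClosed (P : Set A))
    (y : ι → A) (C : ℝ)
    (h : ∀ g : A, ∃ u : ι → A, (∀ w, ‖u w‖ ≤ C * ‖g‖) ∧
      ∃ p ∈ P, ‖g - p - ∑ w, y w * u w‖ ≤ 1 / 2 * ‖g‖) (g : A) :
    ∃ u : ι → A, g - ∑ w, y w * u w ∈ P := by
  choose u hu p hp hup using h
  set r : A → A := fun g => g - p g - ∑ w, y w * u g w with hr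
  have hrn : ∀ k, ‖r^[k] g‖ ≤ (1 / 2) ^ k * ‖g‖ := by
    intro k
    induction k with
    | zero => simp
    | succ k ih =>
      rw [Function.iterate_succ_apply', pow_succ']
      calc _ ≤ 1 / 2 * ‖r^[k] g‖ := hup _
        _ ≤ _ := by linarith
  have hsum : ∀ w, Summable fun k => u (r^[k] g) w := by
    intro w
    refine Summable.of_norm_bounded (g := fun k => |C| * ((1 / 2) ^ k * ‖g‖)) ?_ ?_
    · exact ((summable_geometric_of_lt_one (by norm_num) (by norm_num)).mul_right _).mul_left _
    · intro k
      refine (hu _ w).trans ?_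
      exact mul_le_mul (le_abs_self C) (hrn k) (norm_nonneg _) (abs_nonneg _)
  have hpart : ∀ K : ℕ,
      g - r^[K] g - ∑ w, y w * ∑ k ∈ Finset.range K, u (r^[k] g) w ∈ P := by
    intro K
    induction K with
    | zero => simp
    | succ K ih =>
      have : g - r^[K + 1] g - ∑ w, y w * ∑ k ∈ Finset.range (K + 1), u (r^[k] g) w
          = (g - r^[K] g - ∑ w, y w * ∑ k ∈ Finset.range K, u (r^[k] g) w) + p (r^[K] g) := by
        simp only [Finset.sum_range_succ, mul_add, Finset.sum_add_distrib]
        rw [Function.iterate_succ_apply', hr]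
        ring
      rw [this]
      exact P.add_mem ih (hp _)
  have hlim0 : Tendsto (fun K => r^[K] g) atTop (𝓝 0) := by
    refine squeeze_zero_norm hrn ?_
    simpa using (tendsto_pow_atTop_nhds_zero_of_lt_one (by norm_num : (0 : ℝ) ≤ 1 / 2)
      (by norm_num)).mul_const ‖g‖
  refine ⟨fun w => ∑' k, u (r^[k] g) w, ?_⟩
  have hlim : Tendsto (fun K => g - r^[K] g - ∑ w, y w * ∑ k ∈ Finset.range K, u (r^[k] g) w)
      atTop (𝓝 (g - 0 - ∑ w, y w * ∑' k, u (r^[k] g) w)) := by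
    refine (tendsto_const_nhds.sub hlim0).sub (tendsto_finsetSum _ fun w _ => ?_)
    exact (hsum w).hasSum.tendsto_sum_nat.const_mul _
  simpa using hP.mem_of_tendsto hlim (Eventually.of_forall hpart)

theorem exists_norm_pow_le_of_spectrum_subset {B : Type*} [NormedRing B] [NormedAlgebra ℂ B]
    [CompleteSpace B] {x : B} (hx : spectrum ℂ x ⊆ {0}) {ε : ℝ} (hε : 0 < ε) :
    ∃ K : ℝ, 0 ≤ K ∧ ∀ k : ℕ, ‖x ^ k‖ ≤ K * ε ^ k := by
  have hr : spectralRadius ℂ x = 0 := by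
    refine le_antisymm (iSup₂_le fun k hk => ?_) bot_le
    simp [show k = 0 from hx hk]
  have ht := spectrum.pow_nnnorm_pow_one_div_tendsto_nhds_spectralRadius x
  rw [hr] at ht
  have hev := ht.eventually (gt_mem_nhds (show (0 : ENNReal) < ENNReal.ofReal ε by simpa using hε))
  obtain ⟨N, hN⟩ := eventually_atTop.1 hev
  refine ⟨1 + ∑ k ∈ Finset.range (N + 1), ‖x ^ k‖ / ε ^ k, by positivity, fun k => ?_⟩
  by_cases hk : k < N + 1
  · have h1 : ‖x ^ k‖ / ε ^ k ≤ ∑ k ∈ Finset.range (N + 1), ‖x ^ k‖ / ε ^ k :=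
      Finset.single_le_sum (f := fun k => ‖x ^ k‖ / ε ^ k) (fun i _ => by positivity)
        (Finset.mem_range.2 hk)
    rw [← div_le_iff₀ (by positivity)]
    linarith
  · have hk0 : k ≠ 0 := by omega
    have h1 := hN k (by omega)
    have h2 : (‖x ^ k‖₊ : ENNReal) ≤ ENNReal.ofReal ε ^ k := by
      have h3 := pow_le_pow_left' h1.le k
      rwa [← ENNReal.rpow_natCast, ← ENNReal.rpow_mul, one_div,
        inv_mul_cancel₀ (by exact_mod_cast hk0), ENNReal.rpow_one] at h3
    have h4 : ‖x ^ k‖ ≤ ε ^ k := by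
      rw [← ENNReal.ofReal_pow hε.le, ← enorm_eq_nnnorm, ← ofReal_norm] at h2
      exact (ENNReal.ofReal_le_ofReal_iff (by positivity)).1 h2
    refine h4.trans (le_mul_of_one_le_left (by positivity) ?_)
    have : 0 ≤ ∑ k ∈ Finset.range (N + 1), ‖x ^ k‖ / ε ^ k := by positivity
    linarith

theorem exists_norm_prod_pow_le_of_spectrum_subset {B : Type*} [NormedCommRing B]
    [NormedAlgebra ℂ B] [CompleteSpace B] {σ : Type*} {x : σ → B}
    (hx : ∀ j, spectrum ℂ (x j) ⊆ {0}) {ε : ℝ} (hε : 0 < ε) (s : Finset σ) :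
    ∃ K : ℝ, 0 ≤ K ∧ ∀ α : σ → ℕ, ‖∏ j ∈ s, x j ^ α j‖ ≤ K * ε ^ ∑ j ∈ s, α j := by
  classical
  induction s using Finset.induction_on with
  | empty => exact ⟨‖(1 : B)‖, norm_nonneg _, fun α => by simp⟩
  | insert a s ha ih =>
    obtain ⟨K, hK, h⟩ := ih
    obtain ⟨K', hK', h'⟩ := exists_norm_pow_le_of_spectrum_subset (hx a) hε
    refine ⟨K' * K, by positivity, fun α => ?_⟩
    rw [Finset.prod_insert ha, Finset.sum_insert ha, pow_add]
    calc _ ≤ ‖x a ^ α a‖ * ‖∏ j ∈ s, x j ^ α j‖ := norm_mul_le _ _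
      _ ≤ (K' * ε ^ α a) * (K * ε ^ ∑ j ∈ s, α j) :=
        mul_le_mul (h' _) (h _) (norm_nonneg _) (by positivity)
      _ = _ := by ring

/-- Iterating a decomposition `g = c + ∑ xⱼ hⱼ` with bounds expands every element into a
polynomial part and a combination of monomials of degree `n`. -/
theorem exists_monomial_expansion {A : Type*} [NormedCommRing A] [NormedAlgebra ℂ A]
    {σ : Type} [Fintype σ] (x : σ → A) (C : ℝ) (hC : 0 ≤ C)
    (h : ∀ g : A, ∃ (c : ℂ) (u : σ → A), g = algebraMap ℂ A c + ∑ j, x j * u j ∧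
      ∀ j, ‖u j‖ ≤ C * ‖g‖) (n : ℕ) :
    ∃ (ι : Type) (_ : Fintype ι) (α : ι → σ → ℕ) (P : Submodule ℂ A),
      FiniteDimensional ℂ P ∧ Fintype.card ι = Fintype.card σ ^ n ∧ (∀ i, ∑ j, α i j = n) ∧
      ∀ g : A, ∃ u : ι → A, (∀ i, ‖u i‖ ≤ C ^ n * ‖g‖) ∧
        ∃ p ∈ P, g = p + ∑ i, (∏ j, x j ^ α i j) * u i := by
  classical
  induction n with
  | zero =>
    refine ⟨Unit, inferInstance, fun _ _ => 0, ⊥, inferInstance, by simp, by simp, fun g =>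
      ⟨fun _ => g, by simp, 0, by simp, by simp⟩⟩
  | succ n ih =>
    obtain ⟨ι, _, α, P, hP, hι, hα, hg⟩ := ih
    refine ⟨ι × σ, inferInstance, fun i => α i.1 + Pi.single i.2 1,
      P ⊔ Submodule.span ℂ (range fun i => ∏ j, x j ^ α i j), ?_, ?_, ?_, ?_⟩
    · have := FiniteDimensional.span_of_finite ℂ (finite_range fun i => ∏ j, x j ^ α i j)
      infer_instance
    · simp [hι, pow_succ]
    · intro i
      simp [Finset.sum_add_distrib, hα]
    · intro g
      obtain ⟨u, hu, p, hp, hgp⟩ := hg g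
      choose c v hv hvn using fun i => h (u i)
      refine ⟨fun i => v i.1 i.2, fun i => ?_, p + ∑ i, c i • ∏ j, x j ^ α i j, ?_, ?_⟩
      · calc _ ≤ C * ‖u i.1‖ := hvn _ _
          _ ≤ C * (C ^ n * ‖g‖) := mul_le_mul_of_nonneg_left (hu _) hC
          _ = _ := by ring
      · refine Submodule.add_mem_sup hp (Submodule.sum_mem _ fun i _ =>
          Submodule.smul_mem _ _ (Submodule.subset_span ⟨i, rfl⟩))
      · conv_lhs => rw [hgp]
        rw [add_assoc, Fintype.sum_prod_type, ← Finset.sum_add_distrib]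
        congr 1
        refine Finset.sum_congr rfl fun i _ => ?_
        conv_lhs => rw [hv i]
        rw [mul_add, Algebra.smul_def, mul_comm (algebraMap ℂ A (c i)), Finset.mul_sum]
        congr 1
        refine Finset.sum_congr rfl fun k _ => ?_
        simp only [Pi.add_apply, pow_add, Finset.prod_mul_distrib]
        have : ∏ j, x j ^ (Pi.single k 1 : σ → ℕ) j = x k := by
          rw [Finset.prod_eq_single k]
          · simp
          · intro b _ hb
            simp [Pi.single_eq_of_ne hb]
          · simp
        rw [this]
        ring

theorem exists_bound_of_decomposition {A : Type*} [NormedCommRing A] [NormedAlgebra ℂ A]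
    [CompleteSpace A] {σ : Type} [Fintype σ] (x : σ → A)
    (h : ∀ g : A, ∃ (c : ℂ) (u : σ → A), g = algebraMap ℂ A c + ∑ j, x j * u j) :
    ∃ C : ℝ, 0 < C ∧ ∀ g : A, ∃ (c : ℂ) (u : σ → A), g = algebraMap ℂ A c + ∑ j, x j * u j ∧
      ∀ j, ‖u j‖ ≤ C * ‖g‖ := by
  let T : (ℂ × (σ → A)) →L[ℂ] A :=
    (Algebra.linearMap ℂ A).toContinuousLinearMap.comp (ContinuousLinearMap.fst ℂ ℂ (σ → A)) +
    (∑ j, (ContinuousLinearMap.mul ℂ A (x j)).comp (ContinuousLinearMap.proj j)).comp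
      (ContinuousLinearMap.snd ℂ ℂ (σ → A))
  have hT : ∀ q, T q = algebraMap ℂ A q.1 + ∑ j, x j * q.2 j := by
    intro q
    simp [T]
  obtain ⟨C, hC, hb⟩ := T.exists_preimage_norm_le (fun g => by
    obtain ⟨c, u, hcu⟩ := h g
    exact ⟨(c, u), by rw [hT, hcu]⟩)
  refine ⟨C, hC, fun g => ?_⟩
  obtain ⟨q, hq, hqn⟩ := hb g
  exact ⟨q.1, q.2, by rw [← hq, hT], fun j =>
    ((norm_le_pi_norm q.2 j).trans (norm_snd_le q)).trans hqn⟩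

theorem exists_pow_span_le_of_isMaximal {A : Type*} [NormedCommRing A] [NormedAlgebra ℂ A]
    [CompleteSpace A] {σ : Type} [Fintype σ] (x : σ → A)
    (h : ∀ g : A, ∃ (c : ℂ) (u : σ → A), g = algebraMap ℂ A c + ∑ j, x j * u j)
    (I : Ideal A) (hI : ∀ P : Ideal A, P.IsMaximal → I ≤ P → ∀ j, x j ∈ P) :
    ∃ N : ℕ, Ideal.span (range x) ^ N ≤ I := by
  classical
  obtain ⟨C, hC, hb⟩ := exists_bound_of_decomposition x h
  -- the generators are quasinilpotent modulo the closure of `I`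
  have hcl : IsClosed (I.closure : Set A) := by rw [Ideal.coe_closure]; exact isClosed_closure
  have hspec : ∀ j, spectrum ℂ (Ideal.Quotient.mk I.closure (x j)) ⊆ {0} := by
    intro j c hc
    by_contra hc0
    apply hc
    have hc0 : c ≠ 0 := hc0
    have htop : I.closure ⊔ Ideal.span {algebraMap ℂ A c - x j} = ⊤ := by
      by_contra hne
      obtain ⟨P, hP, hle⟩ := Ideal.exists_le_maximal _ hne
      have h1 : x j ∈ P := hI P hP
        (fun a ha => hle (Ideal.mem_sup_left (show a ∈ (I.closure : Set A) by
          rw [Ideal.coe_closure]; exact subset_closure ha))) j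
      have h2 : algebraMap ℂ A c - x j ∈ P :=
        hle (Ideal.mem_sup_right (Ideal.mem_span_singleton_self _))
      have h3 : algebraMap ℂ A c ∈ P := by simpa using P.add_mem h2 h1
      exact hP.ne_top (P.eq_top_of_isUnit_mem h3 ((isUnit_iff_ne_zero.2 hc0).map _))
    have h1 : (1 : A) ∈ I.closure ⊔ Ideal.span {algebraMap ℂ A c - x j} := by simp [htop]
    obtain ⟨a, ha, b, hb, hab⟩ := Submodule.mem_sup.1 h1
    obtain ⟨t, rfl⟩ := Ideal.mem_span_singleton'.1 hb
    have h2 := congrArg (Ideal.Quotient.mk I.closure) hab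
    rw [map_add, Ideal.Quotient.eq_zero_iff_mem.2 ha, zero_add, map_mul, map_sub, map_one] at h2
    exact IsUnit.of_mul_eq_one_right _ h2
  set D : ℝ := (Fintype.card σ : ℝ) with hD
  set ε : ℝ := 1 / (2 * (D * C + 1)) with hεd
  have hε : 0 < ε := by positivity
  obtain ⟨K, hK, hKb⟩ := exists_norm_prod_pow_le_of_spectrum_subset hspec hε Finset.univ
  have hq : D * C * ε < 1 := by
    rw [hεd, mul_one_div, div_lt_one (by positivity)]
    nlinarith [show 0 ≤ D * C by positivity]
  have hq0 : 0 ≤ D * C * ε := by positivity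
  obtain ⟨n, hn⟩ := ((tendsto_pow_atTop_nhds_zero_of_lt_one hq0 hq).const_mul
    (K + 1)).eventually (gt_mem_nhds (show (K + 1) * 0 < (1 / 2 : ℝ) by norm_num)) |>.exists
  obtain ⟨ι, _, α, P, hP, hι, hα, hg⟩ := exists_monomial_expansion x C hC.le hb n
  have happ : ∀ i, ∃ y ∈ I, ‖∏ j, x j ^ α i j - y‖ ≤ (K + 1) * ε ^ n := by
    intro i
    have h1 : ‖Ideal.Quotient.mk I.closure (∏ j, x j ^ α i j)‖ ≤ K * ε ^ n := by
      have := hKb (α i)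
      rw [hα] at this
      simpa [map_prod] using this
    have hε' : 0 < ε ^ n := by positivity
    obtain ⟨m, hm, hmn⟩ := Ideal.Quotient.norm_mk_lt
      (Ideal.Quotient.mk I.closure (∏ j, x j ^ α i j)) (half_pos hε')
    have h2 : ∏ j, x j ^ α i j - m ∈ closure (I : Set A) := by
      rw [← Ideal.coe_closure]
      exact Ideal.Quotient.eq.1 hm.symm
    obtain ⟨y, hy, hyd⟩ := Metric.mem_closure_iff.1 h2 _ (half_pos hε')
    refine ⟨y, hy, ?_⟩
    rw [dist_eq_norm] at hyd
    calc _ = ‖m + (∏ j, x j ^ α i j - m - y)‖ := by congr 1; ring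
      _ ≤ ‖m‖ + ‖∏ j, x j ^ α i j - m - y‖ := norm_add_le _ _
      _ ≤ _ := by linarith
  choose y hyI hy using happ
  have hPc : IsClosed (P : Set A) := P.closed_of_finiteDimensional
  have key := exists_sub_sum_mem_of_approx P hPc y (C ^ n) (fun g => by
    obtain ⟨u, hu, p, hp, hgp⟩ := hg g
    refine ⟨u, hu, p, hp, ?_⟩
    have : g - p - ∑ w, y w * u w = ∑ w, (∏ j, x j ^ α w j - y w) * u w := by
      conv_lhs => rw [hgp]
      simp only [sub_mul, Finset.sum_sub_distrib]
      ring
    rw [this]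
    calc _ ≤ ∑ w, ‖(∏ j, x j ^ α w j - y w) * u w‖ := norm_sum_le _ _
      _ ≤ ∑ w : ι, ((K + 1) * ε ^ n) * (C ^ n * ‖g‖) := by
        refine Finset.sum_le_sum fun w _ => (norm_mul_le _ _).trans ?_
        exact mul_le_mul (hy w) (hu w) (norm_nonneg _) (by positivity)
      _ = ((K + 1) * (D * C * ε) ^ n) * ‖g‖ := by
        rw [Finset.sum_const, Finset.card_univ, hι, nsmul_eq_mul, mul_pow, mul_pow]
        push_cast
        ring
      _ ≤ _ := mul_le_mul_of_nonneg_right hn.le (norm_nonneg _))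
  -- hence the quotient is finite dimensional
  have hfin : FiniteDimensional ℂ (A ⧸ I) := by
    let f : P →ₗ[ℂ] A ⧸ I := (Ideal.Quotient.mkₐ ℂ I).toLinearMap.comp P.subtype
    refine Module.Finite.of_surjective f fun q => ?_
    obtain ⟨g, rfl⟩ := Ideal.Quotient.mk_surjective q
    obtain ⟨u, hu⟩ := key g
    refine ⟨⟨_, hu⟩, ?_⟩
    change Ideal.Quotient.mk I _ = _
    rw [Ideal.Quotient.eq]
    rw [Submodule.subtype_apply, sub_sub_cancel_left]
    exact I.neg_mem (I.sum_mem fun w _ => I.mul_mem_right _ (hyI w))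
  have hart : IsArtinianRing (A ⧸ I) := IsArtinianRing.of_finite ℂ _
  obtain ⟨N, hN⟩ := IsArtinianRing.isNilpotent_jacobson_bot (R := A ⧸ I)
  refine ⟨N, ?_⟩
  have hle : (Ideal.span (range x)).map (Ideal.Quotient.mk I) ≤ Ideal.jacobson ⊥ := by
    rw [Ideal.map_le_iff_le_comap, Ideal.span_le]
    rintro _ ⟨j, rfl⟩
    refine Ideal.mem_sInf.2 ?_
    rintro P ⟨-, hP⟩
    have : (P.comap (Ideal.Quotient.mk I)).IsMaximal :=
      Ideal.comap_isMaximal_of_surjective _ Ideal.Quotient.mk_surjective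
    exact hI _ this (fun a ha => by
      rw [Ideal.mem_comap, Ideal.Quotient.eq_zero_iff_mem.2 ha]; exact P.zero_mem) j
  have h0 : ((Ideal.span (range x)) ^ N).map (Ideal.Quotient.mk I) ≤ ⊥ := by
    rw [Ideal.map_pow]
    exact (Ideal.pow_right_mono hle N).trans hN.le
  rwa [Ideal.map_le_iff_le_comap, ← RingHom.ker_eq_comap_bot, Ideal.mk_ker] at h0

theorem exists_idempotent_mod {A : Type*} [CommRing A] (I M : Ideal A) (hM : M.FG) (N : ℕ)
    (h : M ^ N ≤ M ^ (N + 1) ⊔ I) :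
    ∃ e ∈ M ⊔ I, e * e - e ∈ I ∧ M ^ (N + 1) ≤ Ideal.span {e} ⊔ I := by
  set m := M.map (Ideal.Quotient.mk I) with hm
  have h1 : m ^ N ≤ m ^ (N + 1) := by
    have := Ideal.map_mono (f := Ideal.Quotient.mk I) h
    rwa [Ideal.map_sup, Ideal.map_quotient_self, sup_bot_eq, Ideal.map_pow, Ideal.map_pow] at this
  have h2 : ∀ k, m ^ N ≤ m ^ (N + k) := by
    intro k
    induction k with
    | zero => exact le_rfl
    | succ k ih =>
      calc m ^ N ≤ m ^ (N + 1) := h1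
        _ = m * m ^ N := pow_succ' _ _
        _ ≤ m * m ^ (N + k) := Ideal.mul_mono_right ih
        _ = _ := by rw [← pow_succ']; rfl
  have h3 : IsIdempotentElem (m ^ (N + 1)) := by
    refine le_antisymm Ideal.mul_le_left ?_
    calc m ^ (N + 1) = m * m ^ N := pow_succ' _ _
      _ ≤ m * m ^ (N + (N + 1)) := Ideal.mul_mono_right (h2 _)
      _ = _ := by rw [← pow_succ', ← pow_add]; congr 1; ring
  obtain ⟨e', he', hspan⟩ := (Ideal.isIdempotentElem_iff_of_fg _ ((hM.map _).pow)).1 h3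
  obtain ⟨e, rfl⟩ := Ideal.Quotient.mk_surjective e'
  have hcomap : ∀ K : Ideal A, (K.map (Ideal.Quotient.mk I)).comap (Ideal.Quotient.mk I) = K ⊔ I := by
    intro K
    rw [Ideal.comap_map_of_surjective _ Ideal.Quotient.mk_surjective, ← RingHom.ker_eq_comap_bot,
      Ideal.mk_ker]
  refine ⟨e, ?_, ?_, ?_⟩
  · rw [← hcomap, Ideal.mem_comap]
    refine Ideal.pow_le_self (Nat.succ_ne_zero N) (?_ : _ ∈ m ^ (N + 1))
    rw [hspan]
    exact Ideal.mem_span_singleton_self _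
  · rw [← Ideal.Quotient.eq, map_mul]
    exact he'
  · rw [← hcomap, ← Ideal.map_le_iff_le_comap, Ideal.map_pow, Ideal.map_span, image_singleton]
    exact hspan.le

theorem exists_tangential_correction {E : Type*} [NormedAddCommGroup E] [InnerProductSpace ℂ E]
    {z l v : E} {δ : ℝ} (hδ : 0 < δ) (hl : ‖l‖ ≤ 1 - 2 * δ) (hz : ‖z‖ ≤ 1) (hv : ‖v‖ ≤ 1) :
    ∃ c : ℂ, ‖c‖ ≤ 2 / δ ∧ ∀ s : ℝ, 0 < s → s ≤ 1 → ∀ w : ℂ,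
      ‖w‖ ≤ δ / (4 * (1 + 4 / δ)) * √s →
      ‖(z + (s : ℂ) • (l - z)) + w • (v - c • (z - l))‖ ≤ 1 := by
  have hl0 := norm_nonneg l
  have hδ1 : δ ≤ 1 / 2 := by linarith
  set B : ℝ := 1 + 4 / δ with hB
  have hB1 : 1 ≤ B := by rw [hB]; linarith [show 0 < 4 / δ by positivity]
  set κ : ℝ := δ / (4 * B) with hκ
  have hκ0 : 0 < κ := by positivity
  have hκB : κ * B = δ / 4 := by rw [hκ]; field_simp
  have hκδ : κ ≤ δ / 4 := by nlinarith
  have hu : ∀ s : ℝ, 0 < s → s ≤ 1 → ‖z + (s : ℂ) • (l - z)‖ ≤ (1 - s) * ‖z‖ + s * ‖l‖ := by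
    intro s hs hs1
    calc _ = ‖((1 - s : ℝ) : ℂ) • z + (s : ℂ) • l‖ := by
          congr 1; push_cast; module
      _ ≤ _ := norm_add_le _ _
      _ = _ := by
        rw [norm_smul, norm_smul, Complex.norm_real, Complex.norm_real, Real.norm_of_nonneg hs.le,
          Real.norm_of_nonneg (by linarith)]
  by_cases hzδ : ‖z‖ ≤ 1 - δ
  · refine ⟨0, by simp; positivity, fun s hs hs1 w hw => ?_⟩
    have h1 := hu s hs hs1
    have h2 : √s ≤ 1 := Real.sqrt_le_one.2 hs1
    have h3 : ‖w‖ ≤ κ := hw.trans (mul_le_of_le_one_right hκ0.le h2)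
    calc _ ≤ ‖z + (s : ℂ) • (l - z)‖ + ‖w • (v - (0 : ℂ) • (z - l))‖ := norm_add_le _ _
      _ ≤ ((1 - s) * ‖z‖ + s * ‖l‖) + κ * 1 := by
        refine add_le_add h1 ?_
        rw [norm_smul, zero_smul, sub_zero]
        exact mul_le_mul h3 hv (norm_nonneg _) hκ0.le
      _ ≤ 1 := by nlinarith
  · push Not at hzδ
    have hz0 : 0 < ‖z‖ := by linarith
    have hin : δ / 2 ≤ ‖inner ℂ z (z - l)‖ := by
      have h1 : inner ℂ z (z - l) = (‖z‖ : ℂ) ^ 2 - inner ℂ z l := by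
        rw [inner_sub_right, inner_self_eq_norm_sq_to_K]; rfl
      have h2 : ‖inner ℂ z l‖ ≤ ‖z‖ * ‖l‖ := norm_inner_le_norm _ _
      have h3 : ‖((‖z‖ : ℂ)) ^ 2‖ = ‖z‖ ^ 2 := by simp
      have h4 := norm_sub_norm_le (((‖z‖ : ℂ)) ^ 2) (inner ℂ z l)
      rw [h3, ← h1] at h4
      have h5 : δ ≤ ‖z‖ - ‖l‖ := by linarith
      have h6 : 1 / 2 ≤ ‖z‖ := by linarith
      nlinarith [mul_le_mul h6 h5 hδ.le hz0.le]
    have hin0 : inner ℂ z (z - l) ≠ 0 := by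
      intro h; rw [h, norm_zero] at hin; linarith
    have hc : ‖inner ℂ z v / inner ℂ z (z - l)‖ ≤ 2 / δ := by
      rw [norm_div, show 2 / δ = 1 / (δ / 2) by field_simp]
      refine div_le_div₀ zero_le_one ?_ (by positivity) hin
      exact (norm_inner_le_norm _ _).trans (mul_le_one₀ hz (norm_nonneg _) hv)
    set c := inner ℂ z v / inner ℂ z (z - l) with hcd
    have hzl : ‖l - z‖ ≤ 2 := (norm_sub_le _ _).trans (by linarith)
    set v' := v - c • (z - l) with hv'
    have horth : inner ℂ z v' = 0 := by
      rw [hv', inner_sub_right, inner_smul_right, hcd, div_mul_cancel₀ _ hin0, sub_self]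
    have hv'B : ‖v'‖ ≤ B := by
      refine (norm_sub_le _ _).trans ?_
      rw [norm_smul, norm_sub_rev z l, hB]
      have : ‖c‖ * ‖l - z‖ ≤ 2 / δ * 2 := mul_le_mul hc hzl (norm_nonneg _) (by positivity)
      linarith [show 2 / δ * 2 = 4 / δ by ring]
    refine ⟨c, hc, fun s hs hs1 w hw => ?_⟩
    set u := z + (s : ℂ) • (l - z) with hud
    have h1 : ‖u‖ ≤ 1 - 2 * δ * s := (hu s hs hs1).trans (by nlinarith)
    have h2 : ‖inner ℂ u v'‖ ≤ s * 2 * B := by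
      rw [hud, inner_add_left, horth, zero_add, inner_smul_left, norm_mul, RCLike.norm_conj,
        Complex.norm_real, Real.norm_of_nonneg hs.le, mul_assoc]
      refine mul_le_mul_of_nonneg_left ((norm_inner_le_norm _ _).trans ?_) hs.le
      exact mul_le_mul hzl hv'B (norm_nonneg _) (by norm_num)
    have hwB : ‖w‖ * B ≤ δ / 4 * √s := by
      calc _ ≤ κ * √s * B := mul_le_mul_of_nonneg_right hw (by positivity)
        _ = _ := by rw [← hκB]; ring
    have hss : √s ≤ 1 := Real.sqrt_le_one.2 hs1
    have hsq : √s ^ 2 = s := Real.sq_sqrt hs.le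
    have hw0 : 0 ≤ ‖w‖ * B := by positivity
    have hwB1 : ‖w‖ * B ≤ δ / 4 := hwB.trans (mul_le_of_le_one_right (by positivity) hss)
    have hwB2 : (‖w‖ * B) ^ 2 ≤ δ ^ 2 / 16 * s := by
      calc _ ≤ (δ / 4 * √s) ^ 2 := pow_le_pow_left₀ hw0 hwB 2
        _ = _ := by rw [mul_pow, hsq]; ring
    have h3 : RCLike.re (inner ℂ u (w • v')) ≤ ‖w‖ * (s * 2 * B) := by
      refine (RCLike.re_le_norm _).trans ?_
      rw [inner_smul_right, norm_mul]
      exact mul_le_mul_of_nonneg_left h2 (norm_nonneg _)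
    have h4 : ‖w • v'‖ ≤ ‖w‖ * B := by
      rw [norm_smul]; exact mul_le_mul_of_nonneg_left hv'B (norm_nonneg _)
    have h5 : ‖u + w • v'‖ ^ 2 ≤ 1 := by
      rw [@norm_add_sq ℂ]
      have h6 : ‖u‖ ^ 2 ≤ (1 - 2 * δ * s) ^ 2 := pow_le_pow_left₀ (norm_nonneg _) h1 2
      have h7 : ‖w • v'‖ ^ 2 ≤ (‖w‖ * B) ^ 2 := pow_le_pow_left₀ (norm_nonneg _) h4 2
      have h8 : ‖w‖ * (s * 2 * B) ≤ δ / 4 * (2 * s) := by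
        calc _ = ‖w‖ * B * (2 * s) := by ring
          _ ≤ _ := mul_le_mul_of_nonneg_right hwB1 (by positivity)
      have h9 : δ * s ≤ 1 / 2 := (mul_le_of_le_one_right hδ.le hs1).trans hδ1
      have h10 : 0 < δ * s := by positivity
      have h11 : (δ * s) * (δ * s) ≤ 1 / 2 * (δ * s) := mul_le_mul_of_nonneg_right h9 h10.le
      have h12 : δ * (δ * s) ≤ 1 / 2 * (δ * s) := mul_le_mul_of_nonneg_right hδ1 h10.le
      have h13 : ‖u‖ ^ 2 + 2 * RCLike.re (inner ℂ u (w • v')) + ‖w • v'‖ ^ 2 ≤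
          (1 - 2 * δ * s) ^ 2 + 2 * (δ / 4 * (2 * s)) + δ ^ 2 / 16 * s := by
        linarith [h3.trans h8, h7.trans hwB2]
      have h14 : (1 - 2 * δ * s) ^ 2 + 2 * (δ / 4 * (2 * s)) + δ ^ 2 / 16 * s =
          1 - 3 * (δ * s) + 4 * ((δ * s) * (δ * s)) + δ * (δ * s) / 16 := by ring
      linarith
    exact (sq_le_one_iff₀ (norm_nonneg _)).1 h5

theorem hasDerivAt_eval_line {σ : Type*} [Fintype σ] (R : MvPolynomial σ ℂ) (a b : σ → ℂ) (s : ℂ) :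
    HasDerivAt (fun t : ℂ => MvPolynomial.eval (fun j => a j + t * b j) R)
      (∑ j, b j * MvPolynomial.eval (fun k => a k + s * b k) (MvPolynomial.pderiv j R)) s := by
  classical
  induction R using MvPolynomial.induction_on with
  | C c => simpa using hasDerivAt_const s c
  | add p q hp hq =>
    simp only [map_add, mul_add, Finset.sum_add_distrib]
    exact hp.add hq
  | mul_X p i hp =>
    have hX : HasDerivAt (fun t : ℂ => a i + t * b i) (b i) s := by
      simpa using ((hasDerivAt_id s).mul_const (b i)).const_add (a i)
    have hm := hp.mul hX
    refine (hm.congr_deriv ?_).congr_of_eventuallyEq (Eventually.of_forall fun t => by simp)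
    simp only [Derivation.leibniz, MvPolynomial.pderiv_X, smul_eq_mul, map_add, map_mul,
      MvPolynomial.eval_X, mul_add, Finset.sum_add_distrib]
    rw [add_comm]
    congr 1
    · rw [Finset.sum_eq_single i]
      · simp [mul_comm]
      · intro j _ hj
        simp [Pi.single_eq_of_ne hj.symm]
      · simp
    · rw [← mul_add, Finset.sum_mul]
      exact Finset.sum_congr rfl fun j _ => by ring

/-- The ball algebra as a Banach algebra. -/
abbrev BallAlgebra (d : ℕ) : Type := ballAlgSub d

instance (d : ℕ) : CompleteSpace (BallAlgebra d) :=
  (polyAlg d).isClosed_topologicalClosure.completeSpace_coe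

/-- The coordinate functions. -/
def ballCoord (d : ℕ) (j : Fin d) : BallAlgebra d :=
  ⟨⟨fun z => (z : EuclideanSpace ℂ (Fin d)) j,
      (EuclideanSpace.proj (𝕜 := ℂ) j).continuous.comp continuous_subtype_val⟩,
    (polyAlg d).le_topologicalClosure (Algebra.subset_adjoin ⟨j, rfl⟩)⟩

/-- Evaluation at a point of the closed ball. -/
def ballEval (d : ℕ) (z : CB d) : BallAlgebra d →ₐ[ℂ] ℂ :=
  (ContinuousMap.evalAlgHom ℂ ℂ z).comp (ballAlgSub d).val

@[simp]
theorem ballEval_ballCoord (d : ℕ) (z : CB d) (j : Fin d) :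
    ballEval d z (ballCoord d j) = (z : EuclideanSpace ℂ (Fin d)) j := rfl

theorem norm_ballEval_le (d : ℕ) (z : CB d) (f : BallAlgebra d) : ‖ballEval d z f‖ ≤ ‖f‖ :=
  f.1.norm_coe_le_norm z

theorem BallAlgebra.ext_ballEval {d : ℕ} {f g : BallAlgebra d}
    (h : ∀ z, ballEval d z f = ballEval d z g) : f = g :=
  Subtype.ext (ContinuousMap.ext h)

theorem BallAlgebra.norm_le {d : ℕ} {f : BallAlgebra d} {C : ℝ} (hC : 0 ≤ C)
    (h : ∀ z, ‖ballEval d z f‖ ≤ C) : ‖f‖ ≤ C :=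
  (ContinuousMap.norm_le f.1 hC).2 h

theorem ballEval_aeval {d : ℕ} (z : CB d) (a : Fin d → BallAlgebra d)
    (R : MvPolynomial (Fin d) ℂ) :
    ballEval d z (MvPolynomial.aeval a R) = MvPolynomial.eval (fun j => ballEval d z (a j)) R := by
  induction R using MvPolynomial.induction_on with
  | C c => simp
  | add p q hp hq => simp only [map_add, hp, hq]
  | mul_X p i hp => simp only [map_mul, MvPolynomial.aeval_X, MvPolynomial.eval_X, hp]

theorem exists_norm_sub_aeval_lt {d : ℕ} (g : BallAlgebra d) {ε : ℝ} (hε : 0 < ε) :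
    ∃ R : MvPolynomial (Fin d) ℂ, ‖g - MvPolynomial.aeval (ballCoord d) R‖ < ε := by
  have h1 : g.1 ∈ closure (polyAlg d : Set C(CB d, ℂ)) := g.2
  obtain ⟨p, hp, hpg⟩ := Metric.mem_closure_iff.1 h1 ε hε
  have h2 : polyAlg d ≤
      ((ballAlgSub d).val.comp (MvPolynomial.aeval (R := ℂ) (ballCoord d))).range := by
    refine Algebra.adjoin_le ?_
    rintro _ ⟨j, rfl⟩
    exact ⟨MvPolynomial.X j, by simp; rfl⟩
  obtain ⟨R, rfl⟩ := h2 hp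
  refine ⟨R, ?_⟩
  rwa [dist_eq_norm] at hpg

theorem norm_sum_mul_eval_pderiv_le {d : ℕ} (R : MvPolynomial (Fin d) ℂ)
    (a b : EuclideanSpace ℂ (Fin d)) {r : ℝ} (hr : 0 < r)
    (h : ∀ w : ℂ, ‖w‖ ≤ r → ‖a + w • b‖ ≤ 1) :
    ‖∑ j, b j * MvPolynomial.eval (fun k => a k) (MvPolynomial.pderiv j R)‖ ≤
      ‖MvPolynomial.aeval (ballCoord d) R‖ / r := by
  have hd := hasDerivAt_eval_line R (fun k => a k) (fun k => b k)
  have h0 := (hd 0).deriv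
  simp only [zero_mul, add_zero] at h0
  rw [← h0]
  refine Complex.norm_deriv_le_of_forall_mem_sphere_norm_le hr
    (Differentiable.diffContOnCl fun s => (hd s).differentiableAt) fun w hw => ?_
  have hw' : ‖w‖ ≤ r := (mem_sphere_zero_iff_norm.1 hw).le
  have hm : a + w • b ∈ CB d := mem_closedBall_zero_iff.2 (h w hw')
  have := norm_ballEval_le d ⟨a + w • b, hm⟩ (MvPolynomial.aeval (ballCoord d) R)
  rw [ballEval_aeval] at this
  exact this

theorem continuous_aeval_of_continuous {σ X B : Type*} [TopologicalSpace X] [NormedCommRing B]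
    [NormedAlgebra ℂ B] (R : MvPolynomial σ ℂ) (a : X → σ → B) (ha : ∀ j, Continuous fun x => a x j) :
    Continuous fun x => MvPolynomial.aeval (a x) R := by
  induction R using MvPolynomial.induction_on with
  | C c => simpa using continuous_const
  | add p q hp hq => simpa only [map_add] using hp.fun_add hq
  | mul_X p i hp => simpa only [map_mul, MvPolynomial.aeval_X] using hp.fun_mul (ha i)

/-- The restriction to the closed ball of the composition of a polynomial with the homothety
`z ↦ z + s (l - z)`. -/
def ballHomothety {d : ℕ} (l : EuclideanSpace ℂ (Fin d)) (R : MvPolynomial (Fin d) ℂ) (s : ℝ) :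
    BallAlgebra d :=
  MvPolynomial.aeval (fun k => ballCoord d k + (s : ℂ) • (algebraMap ℂ _ (l k) - ballCoord d k)) R

theorem continuous_ballHomothety {d : ℕ} (l : EuclideanSpace ℂ (Fin d))
    (R : MvPolynomial (Fin d) ℂ) : Continuous (ballHomothety l R) :=
  continuous_aeval_of_continuous R _ fun j => by fun_prop

theorem ballEval_ballHomothety {d : ℕ} (l : EuclideanSpace ℂ (Fin d))
    (R : MvPolynomial (Fin d) ℂ) (s : ℝ) (z : CB d) :
    ballEval d z (ballHomothety l R s) =
      MvPolynomial.eval (fun k => (z.1 + (s : ℂ) • (l - z.1)) k) R := by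
  rw [ballHomothety, ballEval_aeval]
  congr 2

theorem ballEval_integral {d : ℕ} (z : CB d) (f : ℝ → BallAlgebra d) (hf : Continuous f) (a b : ℝ) :
    ballEval d z (∫ s in a..b, f s) = ∫ s in a..b, ballEval d z (f s) := by
  let L : BallAlgebra d →L[ℂ] ℂ := (ballEval d z).toLinearMap.mkContinuous 1 fun f =>
    (norm_ballEval_le d z f).trans_eq (one_mul _).symm
  exact (L.intervalIntegral_comp_comm (hf.intervalIntegrable a b)).symm

theorem integral_radial_derivative {d : ℕ} (l : EuclideanSpace ℂ (Fin d))
    (R : MvPolynomial (Fin d) ℂ) (z : CB d) :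
    ∫ s in (0 : ℝ)..1, ∑ j, (z.1 - l) j *
        ballEval d z (ballHomothety l (MvPolynomial.pderiv j R) s) =
      MvPolynomial.eval (fun k => z.1 k) R - MvPolynomial.eval (fun k => l k) R := by
  have h := fun s : ℝ => (hasDerivAt_eval_line R (fun k => z.1 k) (fun k => (l - z.1) k) s).comp_ofReal
  have hc : Continuous fun s : ℝ => ∑ j, (l - z.1) j *
      MvPolynomial.eval (fun k => z.1 k + (s : ℂ) * (l - z.1) k) (MvPolynomial.pderiv j R) := by
    refine continuous_finsetSum _ fun j _ => continuous_const.mul ?_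
    exact MvPolynomial.continuous_eval _ |>.comp (by fun_prop)
  have := intervalIntegral.integral_eq_sub_of_hasDerivAt (a := 0) (b := 1)
    (fun s _ => h s) (hc.intervalIntegrable 0 1)
  simp only [ballEval_ballHomothety]
  rw [← neg_inj, ← intervalIntegral.integral_neg]
  convert this using 1
  · congr 1
    ext s
    rw [← Finset.sum_neg_distrib]
    refine Finset.sum_congr rfl fun j _ => ?_
    simp
    ring
  · simp

theorem norm_integral_le_of_norm_le_div_sqrt {V : ℝ → ℂ} {F κ : ℝ} (hκ : 0 < κ)
    (h : ∀ s : ℝ, 0 < s → s ≤ 1 → ‖V s‖ ≤ F / (κ * √s)) :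
    ‖∫ s in (0 : ℝ)..1, V s‖ ≤ 2 / κ * F := by
  have hint : IntervalIntegrable (fun s : ℝ => s ^ (-(1 / 2) : ℝ)) volume 0 1 :=
    intervalIntegral.intervalIntegrable_rpow' (by norm_num)
  have hb := intervalIntegral.norm_integral_le_of_norm_le (a := 0) (b := 1) (μ := volume)
    (f := V) (g := fun s => F / κ * s ^ (-(1 / 2) : ℝ)) zero_le_one
    (Eventually.of_forall fun s hs => by
      have hs0 : 0 < √s := Real.sqrt_pos.2 hs.1
      refine (h s hs.1 hs.2).trans (le_of_eq ?_)
      rw [Real.rpow_neg hs.1.le, ← Real.sqrt_eq_rpow]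
      field_simp) (hint.const_mul _)
  refine hb.trans (le_of_eq ?_)
  rw [intervalIntegral.integral_const_mul, integral_rpow (Or.inl (by norm_num))]
  norm_num
  ring

theorem norm_integral_tangential_le {d : ℕ} (l : EuclideanSpace ℂ (Fin d))
    (R : MvPolynomial (Fin d) ℂ) (z : CB d) (v : EuclideanSpace ℂ (Fin d)) {κ : ℝ} (hκ0 : 0 < κ)
    (hv : ∀ s : ℝ, 0 < s → s ≤ 1 → ∀ w : ℂ, ‖w‖ ≤ κ * √s →
      ‖z.1 + (s : ℂ) • (l - z.1) + w • v‖ ≤ 1) :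
    ‖∫ s in (0 : ℝ)..1, ∑ k, v k *
      ballEval d z (ballHomothety l (MvPolynomial.pderiv k R) s)‖ ≤
        2 / κ * ‖MvPolynomial.aeval (ballCoord d) R‖ := by
  refine norm_integral_le_of_norm_le_div_sqrt hκ0 fun s hs0 hs1 => ?_
  simp only [ballEval_ballHomothety]
  exact norm_sum_mul_eval_pderiv_le R _ v (mul_pos hκ0 (Real.sqrt_pos.2 hs0)) (hv s hs0 hs1)

theorem exists_gleason_polynomial {d : ℕ} (l : EuclideanSpace ℂ (Fin d)) (hl : ‖l‖ < 1) :
    ∃ C : ℝ, 0 ≤ C ∧ ∀ R : MvPolynomial (Fin d) ℂ, ∃ u : Fin d → BallAlgebra d,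
      (∀ j, ‖u j‖ ≤ C * ‖MvPolynomial.aeval (ballCoord d) R‖) ∧
      MvPolynomial.aeval (ballCoord d) R =
        algebraMap ℂ _ (MvPolynomial.eval (fun k => l k) R) +
          ∑ j, (ballCoord d j - algebraMap ℂ _ (l j)) * u j := by
  set δ : ℝ := (1 - ‖l‖) / 2 with hδd
  have hδ : 0 < δ := by rw [hδd]; linarith
  set κ : ℝ := δ / (4 * (1 + 4 / δ)) with hκ
  have hκ0 : 0 < κ := by positivity
  refine ⟨2 / δ * 2 + 2 / κ, by positivity, fun R => ?_⟩
  set F := MvPolynomial.aeval (ballCoord d) R with hF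
  refine ⟨fun j => ∫ s in (0 : ℝ)..1, ballHomothety l (MvPolynomial.pderiv j R) s, fun j => ?_, ?_⟩
  · refine BallAlgebra.norm_le (by positivity) fun z => ?_
    rw [ballEval_integral _ _ (continuous_ballHomothety _ _)]
    have hz : ‖z.1‖ ≤ 1 := mem_closedBall_zero_iff.1 z.2
    obtain ⟨c, hc, hcw⟩ := exists_tangential_correction (z := z.1) (l := l)
      (v := EuclideanSpace.single j 1) hδ (by rw [hδd]; linarith) hz (by simp)
    set v' : EuclideanSpace ℂ (Fin d) := EuclideanSpace.single j 1 - c • (z.1 - l) with hv'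
    set T : ℝ → ℂ := fun s => ∑ k, (z.1 - l) k *
      ballEval d z (ballHomothety l (MvPolynomial.pderiv k R) s) with hT
    set V : ℝ → ℂ := fun s => ∑ k, v' k *
      ballEval d z (ballHomothety l (MvPolynomial.pderiv k R) s) with hV
    have hcont : ∀ k, Continuous fun s =>
        ballEval d z (ballHomothety l (MvPolynomial.pderiv k R) s) := fun k => by
      simp only [ballEval_ballHomothety]
      exact (MvPolynomial.continuous_eval _).comp (by fun_prop)
    have hTc : Continuous T := continuous_finsetSum _ fun k _ => continuous_const.mul (hcont k)
    have hVc : Continuous V := continuous_finsetSum _ fun k _ => continuous_const.mul (hcont k)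
    have hsplit : ∀ s, ballEval d z (ballHomothety l (MvPolynomial.pderiv j R) s) =
        c * T s + V s := by
      intro s
      rw [hT, hV]
      simp only [Finset.mul_sum, ← Finset.sum_add_distrib]
      rw [Finset.sum_eq_single j]
      · simp [hv']; ring
      · intro k _ hk
        simp [hv', hk]; ring
      · simp
    simp only [hsplit]
    rw [intervalIntegral.integral_add (f := fun s => c * T s) (g := V)
      ((continuous_const.mul hTc).intervalIntegrable _ _) (hVc.intervalIntegrable _ _),
      intervalIntegral.integral_const_mul]
    have hTn : ‖∫ s in (0 : ℝ)..1, T s‖ ≤ 2 * ‖F‖ := by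
      rw [hT, integral_radial_derivative]
      have h1 := norm_ballEval_le d z F
      have h2 := norm_ballEval_le d ⟨l, mem_closedBall_zero_iff.2 hl.le⟩ F
      rw [hF, ballEval_aeval] at h1 h2
      refine (norm_sub_le _ _).trans ?_
      rw [two_mul]
      exact add_le_add h1 h2
    have hVn := norm_integral_tangential_le l R z v' hκ0 hcw
    calc _ ≤ ‖c‖ * ‖∫ s in (0 : ℝ)..1, T s‖ + ‖∫ s in (0 : ℝ)..1, V s‖ := by
          rw [← norm_mul]; exact norm_add_le _ _
      _ ≤ 2 / δ * (2 * ‖F‖) + 2 / κ * ‖F‖ :=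
        add_le_add (mul_le_mul hc hTn (norm_nonneg _) (by positivity)) hVn
      _ = _ := by ring
  · refine BallAlgebra.ext_ballEval fun z => ?_
    have h := integral_radial_derivative l R z
    rw [intervalIntegral.integral_finsetSum] at h
    · rw [hF, ballEval_aeval, map_add, map_sum, AlgHom.commutes]
      simp only [map_mul, map_sub, AlgHom.commutes, ballEval_ballCoord]
      simp only [ballEval_integral _ _ (continuous_ballHomothety _ _),
        ← intervalIntegral.integral_const_mul]
      rw [← sub_eq_iff_eq_add']
      exact h.symm
    · intro j _
      refine Continuous.intervalIntegrable (continuous_const.mul ?_) _ _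
      simp only [ballEval_ballHomothety]
      exact (MvPolynomial.continuous_eval _).comp (by fun_prop)

theorem exists_gleason {d : ℕ} (l : EuclideanSpace ℂ (Fin d)) (hl : ‖l‖ < 1) (g : BallAlgebra d) :
    ∃ (c : ℂ) (u : Fin d → BallAlgebra d),
      g = algebraMap ℂ _ c + ∑ j, (ballCoord d j - algebraMap ℂ _ (l j)) * u j := by
  obtain ⟨C, hC, hp⟩ := exists_gleason_polynomial l hl
  have hfd : FiniteDimensional ℂ (Submodule.span ℂ {(1 : BallAlgebra d)}) := inferInstance
  obtain ⟨u, hu⟩ := exists_sub_sum_mem_of_approx (Submodule.span ℂ {(1 : BallAlgebra d)})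
    (Submodule.closed_of_finiteDimensional _)
    (fun j => ballCoord d j - algebraMap ℂ _ (l j)) (C * 2) (fun g => by
      by_cases hg : g = 0
      · exact ⟨0, by simp [hg], 0, Submodule.zero_mem _, by simp [hg]⟩
      have hg0 : 0 < ‖g‖ := norm_pos_iff.2 hg
      obtain ⟨R, hR⟩ := exists_norm_sub_aeval_lt g (half_pos hg0)
      obtain ⟨u, hu, hRu⟩ := hp R
      refine ⟨u, fun j => ?_, algebraMap ℂ _ (MvPolynomial.eval (fun k => l k) R), ?_, ?_⟩
      · have h1 : ‖MvPolynomial.aeval (ballCoord d) R‖ ≤ 2 * ‖g‖ := by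
          have := norm_sub_norm_le (MvPolynomial.aeval (ballCoord d) R) g
          rw [norm_sub_rev] at this
          linarith
        calc _ ≤ _ := hu j
          _ ≤ C * (2 * ‖g‖) := mul_le_mul_of_nonneg_left h1 hC
          _ = _ := by ring
      · rw [Algebra.algebraMap_eq_smul_one]
        exact Submodule.smul_mem _ _ (Submodule.mem_span_singleton_self _)
      · rw [sub_sub, ← hRu]
        linarith) g
  obtain ⟨c, hc⟩ := Submodule.mem_span_singleton.1 hu
  refine ⟨c, u, ?_⟩
  rw [Algebra.algebraMap_eq_smul_one, hc]
  ring

/-- The ideal generated by the functions `z_j - l_j`. -/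
def ballPointIdeal {d : ℕ} (l : EuclideanSpace ℂ (Fin d)) : Ideal (BallAlgebra d) :=
  Ideal.span (range fun j => ballCoord d j - algebraMap ℂ (BallAlgebra d) (l j))

/-- The ideal of functions vanishing to order at least `K` at `l`. -/
def ballVanishingIdeal {d : ℕ} (l : EuclideanSpace ℂ (Fin d)) (K : ℕ) : Ideal (BallAlgebra d) where
  carrier := {g | ∃ C : ℝ, ∀ z : CB d, ‖ballEval d z g‖ ≤ C * ‖z.1 - l‖ ^ K}
  zero_mem' := ⟨0, fun z => by simp⟩
  add_mem' := by
    rintro a b ⟨C, hC⟩ ⟨D, hD⟩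
    refine ⟨C + D, fun z => ?_⟩
    rw [map_add, add_mul]
    exact (norm_add_le _ _).trans (add_le_add (hC z) (hD z))
  smul_mem' := by
    rintro a b ⟨C, hC⟩
    refine ⟨‖a‖ * C, fun z => ?_⟩
    rw [smul_eq_mul, map_mul, norm_mul, mul_assoc]
    exact mul_le_mul (norm_ballEval_le d z a) (hC z) (norm_nonneg _) (norm_nonneg _)

theorem mem_ballVanishingIdeal {d : ℕ} {l : EuclideanSpace ℂ (Fin d)} {K : ℕ}
    {g : BallAlgebra d} : g ∈ ballVanishingIdeal l K ↔
      ∃ C : ℝ, ∀ z : CB d, ‖ballEval d z g‖ ≤ C * ‖z.1 - l‖ ^ K := Iff.rfl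

theorem ballPointIdeal_pow_le_ballVanishingIdeal {d : ℕ} (l : EuclideanSpace ℂ (Fin d)) (K : ℕ) :
    ballPointIdeal l ^ K ≤ ballVanishingIdeal l K := by
  induction K with
  | zero =>
    intro g _
    exact ⟨‖g‖, fun z => by rw [pow_zero, mul_one]; exact norm_ballEval_le d z g⟩
  | succ K ih =>
    have h1 : ballPointIdeal l ≤ ballVanishingIdeal l 1 := by
      refine Ideal.span_le.2 ?_
      rintro _ ⟨j, rfl⟩
      refine ⟨1, fun z => ?_⟩
      rw [map_sub, AlgHom.commutes, ballEval_ballCoord, pow_one, one_mul]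
      exact PiLp.norm_apply_le (z.1 - l) j
    rw [pow_succ]
    refine Ideal.mul_le.2 fun a ha b hb => ?_
    obtain ⟨C, hC⟩ := ih ha
    obtain ⟨D, hD⟩ := h1 hb
    refine ⟨C * D, fun z => ?_⟩
    rw [map_mul, norm_mul]
    refine (mul_le_mul (hC z) (hD z) (norm_nonneg _)
      ((norm_nonneg _).trans (hC z))).trans (le_of_eq ?_)
    ring

/-- Homogeneity of degree `k` with respect to the homotheties centred at `l`. -/
def BallAlgebra.IsHomogeneousAt {d : ℕ} (l : EuclideanSpace ℂ (Fin d)) (k : ℕ)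
    (q : BallAlgebra d) : Prop :=
  ∀ (z w : CB d) (t : ℝ), w.1 = l + (t : ℂ) • (z.1 - l) →
    ballEval d w q = (t : ℂ) ^ k * ballEval d z q

theorem exists_isHomogeneousAt_one {d : ℕ} {l : EuclideanSpace ℂ (Fin d)} (hl : ‖l‖ < 1)
    {g : BallAlgebra d} (hg : g ∈ ballPointIdeal l) :
    ∃ q, q.IsHomogeneousAt l 1 ∧ g - q ∈ ballPointIdeal l ^ 2 := by
  induction hg using Submodule.span_induction with
  | mem x hx =>
    obtain ⟨j, rfl⟩ := hx
    refine ⟨_, fun z w t hw => ?_, by rw [sub_self]; exact zero_mem _⟩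
    simp [hw]
  | zero => exact ⟨0, fun z w t _ => by simp, by simp⟩
  | add x y _ _ hx hy =>
    obtain ⟨p, hp, hp'⟩ := hx
    obtain ⟨q, hq, hq'⟩ := hy
    refine ⟨p + q, fun z w t hw => ?_, ?_⟩
    · rw [map_add, map_add, hp z w t hw, hq z w t hw, mul_add]
    · rw [add_sub_add_comm]
      exact add_mem hp' hq'
  | smul a x hxm hx =>
    obtain ⟨p, hp, hp'⟩ := hx
    obtain ⟨c, u, rfl⟩ := exists_gleason l hl a
    have hxm' : x ∈ ballPointIdeal l := hxm
    refine ⟨algebraMap ℂ _ c * p, fun z w t hw => ?_, ?_⟩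
    · rw [map_mul, map_mul, hp z w t hw, AlgHom.commutes, AlgHom.commutes]
      ring
    · have : (algebraMap ℂ (BallAlgebra d) c +
          ∑ j, (ballCoord d j - algebraMap ℂ _ (l j)) * u j) • x - algebraMap ℂ _ c * p =
          (∑ j, (ballCoord d j - algebraMap ℂ _ (l j)) * u j) * x +
            algebraMap ℂ _ c * (x - p) := by
        rw [smul_eq_mul]; ring
      rw [this]
      refine add_mem ?_ (Ideal.mul_mem_left _ _ hp')
      rw [pow_two]
      exact Ideal.mul_mem_mul (sum_mem fun j _ =>
        Ideal.mul_mem_right _ _ (Ideal.subset_span ⟨j, rfl⟩)) hxm'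

theorem exists_isHomogeneousAt {d : ℕ} {l : EuclideanSpace ℂ (Fin d)} (hl : ‖l‖ < 1) (k : ℕ)
    {g : BallAlgebra d} (hg : g ∈ ballPointIdeal l ^ k) :
    ∃ q, q.IsHomogeneousAt l k ∧ g - q ∈ ballPointIdeal l ^ (k + 1) := by
  induction k generalizing g with
  | zero =>
    obtain ⟨c, u, rfl⟩ := exists_gleason l hl g
    refine ⟨algebraMap ℂ _ c, fun z w t _ => by simp, ?_⟩
    rw [add_sub_cancel_left, zero_add, pow_one]
    exact sum_mem fun j _ => Ideal.mul_mem_right _ _ (Ideal.subset_span ⟨j, rfl⟩)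
  | succ k ih =>
    rw [pow_succ] at hg
    induction hg using Submodule.mul_induction_on' with
    | mem_mul_mem m hm n hn =>
      obtain ⟨p, hp, hp'⟩ := ih hm
      obtain ⟨q, hq, hq'⟩ := exists_isHomogeneousAt_one hl hn
      refine ⟨p * q, fun z w t hw => ?_, ?_⟩
      · rw [map_mul, map_mul, hp z w t hw, hq z w t hw]
        ring
      · have hqm : q ∈ ballPointIdeal l := by
          have := sub_mem hn (Ideal.pow_le_self two_ne_zero hq')
          rwa [sub_sub_cancel] at this
        have : m * n - p * q = m * (n - q) + (m - p) * q := by ring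
        rw [this]
        refine add_mem ?_ ?_
        · rw [add_assoc, pow_add]
          exact Ideal.mul_mem_mul hm hq'
        · rw [pow_succ]
          exact Ideal.mul_mem_mul hp' hqm
    | add x _ y _ hx hy =>
      obtain ⟨p, hp, hp'⟩ := hx
      obtain ⟨q, hq, hq'⟩ := hy
      refine ⟨p + q, fun z w t hw => ?_, ?_⟩
      · rw [map_add, map_add, hp z w t hw, hq z w t hw, mul_add]
      · rw [add_sub_add_comm]
        exact add_mem hp' hq'

theorem BallAlgebra.IsHomogeneousAt.eq_zero {d : ℕ} {l : EuclideanSpace ℂ (Fin d)} (hl : ‖l‖ < 1)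
    {k : ℕ} {q : BallAlgebra d} (hq : q.IsHomogeneousAt l k)
    (hv : q ∈ ballVanishingIdeal l (k + 1)) : q = 0 := by
  obtain ⟨C, hC⟩ := hv
  refine BallAlgebra.ext_ballEval fun z => ?_
  rw [map_zero]
  have hz : ‖z.1‖ ≤ 1 := mem_closedBall_zero_iff.1 z.2
  have key : ∀ t : ℝ, 0 < t → t ≤ 1 → ‖ballEval d z q‖ ≤ t * (C * ‖z.1 - l‖ ^ (k + 1)) := by
    intro t ht ht1
    have hm : l + (t : ℂ) • (z.1 - l) ∈ CB d :=
      (convex_closedBall _ _).add_smul_sub_mem (mem_closedBall_zero_iff.2 hl.le) z.2 ⟨ht.le, ht1⟩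
    have h := hC ⟨_, hm⟩
    rw [hq z ⟨_, hm⟩ t rfl, norm_mul, norm_pow, add_sub_cancel_left, norm_smul,
      Complex.norm_of_nonneg ht.le] at h
    have h' : t ^ k * ‖ballEval d z q‖ ≤ t ^ k * (t * (C * ‖z.1 - l‖ ^ (k + 1))) :=
      h.trans (le_of_eq (by ring))
    exact le_of_mul_le_mul_left h' (pow_pos ht k)
  have hlim : Tendsto (fun t : ℝ => t * (C * ‖z.1 - l‖ ^ (k + 1))) (𝓝[>] 0) (𝓝 0) := by
    have : Continuous fun t : ℝ => t * (C * ‖z.1 - l‖ ^ (k + 1)) := by fun_prop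
    simpa using (this.tendsto 0).mono_left nhdsWithin_le_nhds
  have := ge_of_tendsto hlim (by
    filter_upwards [Ioc_mem_nhdsGT zero_lt_one] with t ht using key t ht.1 ht.2)
  exact norm_le_zero_iff.1 this

theorem ballVanishingIdeal_le_pow {d : ℕ} {l : EuclideanSpace ℂ (Fin d)} (hl : ‖l‖ < 1) (K : ℕ) :
    ballVanishingIdeal l K ≤ ballPointIdeal l ^ K := by
  induction K with
  | zero => simp
  | succ k ih =>
    intro g hg
    have hgk : g ∈ ballVanishingIdeal l k := by
      obtain ⟨C, hC⟩ := hg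
      refine ⟨|C| * 2, fun z => (hC z).trans ?_⟩
      have h2 : ‖z.1 - l‖ ≤ 2 := by
        have := norm_sub_le z.1 l
        have := mem_closedBall_zero_iff.1 z.2
        linarith
      calc C * ‖z.1 - l‖ ^ (k + 1) ≤ |C| * ‖z.1 - l‖ ^ (k + 1) :=
            mul_le_mul_of_nonneg_right (le_abs_self C) (by positivity)
        _ = |C| * ‖z.1 - l‖ * ‖z.1 - l‖ ^ k := by ring
        _ ≤ |C| * 2 * ‖z.1 - l‖ ^ k := by gcongr
    obtain ⟨q, hq, hq'⟩ := exists_isHomogeneousAt hl k (ih hgk)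
    have hq0 := hq.eq_zero hl (by
      have := sub_mem hg (ballPointIdeal_pow_le_ballVanishingIdeal l _ hq')
      rwa [sub_sub_cancel] at this)
    rwa [hq0, sub_zero] at hq'

theorem exists_ballDilation {d : ℕ} (l : EuclideanSpace ℂ (Fin d)) {r : ℝ} (hr : 0 ≤ r)
    (hlr : ‖l‖ + r ≤ 1) :
    ∃ ρ : BallAlgebra d →ₐ[ℂ] BallAlgebra d, ∀ (f : BallAlgebra d) (z w : CB d),
      w.1 = l + (r : ℂ) • z.1 → ballEval d z (ρ f) = ballEval d w f := by
  have hm : ∀ z : CB d, l + (r : ℂ) • z.1 ∈ CB d := fun z => by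
    have hz : ‖z.1‖ ≤ 1 := mem_closedBall_zero_iff.1 z.2
    refine mem_closedBall_zero_iff.2 ((norm_add_le _ _).trans ?_)
    rw [norm_smul, Complex.norm_of_nonneg hr]
    nlinarith
  let φ : C(CB d, CB d) := ⟨fun z => ⟨l + (r : ℂ) • z.1, hm z⟩, by fun_prop⟩
  let Φ : C(CB d, ℂ) →ₐ[ℂ] C(CB d, ℂ) := ContinuousMap.compRightAlgHom ℂ ℂ φ
  have hΦ : Continuous Φ := ContinuousMap.continuous_precomp φ
  have hpoly : polyAlg d ≤ (polyAlg d).comap Φ := by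
    refine Algebra.adjoin_le ?_
    rintro _ ⟨j, rfl⟩
    have hj := Algebra.subset_adjoin (R := ℂ) (A := C(CB d, ℂ))
      (s := { f : C(CB d, ℂ) | ∃ i : Fin d,
        f = ⟨fun z => (z : EuclideanSpace ℂ (Fin d)) i,
             (EuclideanSpace.proj (𝕜 := ℂ) i).continuous.comp continuous_subtype_val⟩ }) ⟨j, rfl⟩
    have h2 : algebraMap ℂ C(CB d, ℂ) (l j) + (r : ℂ) • _ ∈ polyAlg d :=
      add_mem ((polyAlg d).algebraMap_mem _) ((polyAlg d).smul_mem hj (r : ℂ))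
    exact h2
  have hmem : ∀ f : BallAlgebra d, Φ f.1 ∈ ballAlgSub d := fun f =>
    map_mem_closure (s := (polyAlg d : Set C(CB d, ℂ))) (t := (polyAlg d : Set C(CB d, ℂ)))
      hΦ f.2 fun p hp => hpoly hp
  refine ⟨(Φ.comp (ballAlgSub d).val).codRestrict (ballAlgSub d) hmem, fun f z w hw => ?_⟩
  have : w = φ z := Subtype.ext hw
  rw [this]
  rfl

theorem ballDilation_ballCoord {d : ℕ} {l : EuclideanSpace ℂ (Fin d)} {r : ℝ}
    (hr : 0 ≤ r) (hlr : ‖l‖ + r ≤ 1)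
    {ρ : BallAlgebra d →ₐ[ℂ] BallAlgebra d} (hρ : ∀ (f : BallAlgebra d) (z w : CB d),
      w.1 = l + (r : ℂ) • z.1 → ballEval d z (ρ f) = ballEval d w f) (j : Fin d) :
    ρ (ballCoord d j - algebraMap ℂ _ (l j)) = algebraMap ℂ _ (r : ℂ) * ballCoord d j := by
  refine BallAlgebra.ext_ballEval fun z => ?_
  have hm : l + (r : ℂ) • z.1 ∈ CB d := by
    have hz : ‖z.1‖ ≤ 1 := mem_closedBall_zero_iff.1 z.2
    refine mem_closedBall_zero_iff.2 ((norm_add_le _ _).trans ?_)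
    rw [norm_smul, Complex.norm_of_nonneg hr]
    nlinarith
  rw [hρ _ z ⟨_, hm⟩ rfl]
  simp

theorem exists_forall_eq_ballEval_of_algHom {d : ℕ} (χ : BallAlgebra d →ₐ[ℂ] ℂ)
    (hχ : ∀ f, ‖χ f‖ ≤ ‖f‖) : ∃ w : CB d, ∀ f, χ f = ballEval d w f := by
  set w : EuclideanSpace ℂ (Fin d) := WithLp.toLp 2 fun j => χ (ballCoord d j) with hw
  have hw1 : ‖w‖ ≤ 1 := by
    have h1 : ‖χ (∑ j, algebraMap ℂ _ (star (w j)) * ballCoord d j)‖ = ‖w‖ ^ 2 := by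
      rw [map_sum, ← Real.norm_of_nonneg (sq_nonneg ‖w‖), ← Complex.norm_real,
        EuclideanSpace.norm_sq_eq]
      congr 1
      push_cast
      refine Finset.sum_congr rfl fun j _ => ?_
      rw [map_mul, AlgHom.commutes]
      exact Complex.conj_mul' (w j)
    have h2 : ‖∑ j, algebraMap ℂ (BallAlgebra d) (star (w j)) * ballCoord d j‖ ≤ ‖w‖ := by
      refine BallAlgebra.norm_le (norm_nonneg _) fun z => ?_
      have hz : ‖z.1‖ ≤ 1 := mem_closedBall_zero_iff.1 z.2
      have h3 : ballEval d z (∑ j, algebraMap ℂ (BallAlgebra d) (star (w j)) * ballCoord d j) =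
          inner ℂ w z.1 := by
        rw [map_sum, PiLp.inner_apply]
        refine Finset.sum_congr rfl fun j _ => ?_
        rw [map_mul, AlgHom.commutes, ballEval_ballCoord]
        exact mul_comm _ _
      rw [h3]
      exact (norm_inner_le_norm _ _).trans (mul_le_of_le_one_right (norm_nonneg _) hz)
    have h3 := (h1 ▸ hχ _).trans h2
    by_contra! h4
    nlinarith
  refine ⟨⟨w, mem_closedBall_zero_iff.2 hw1⟩, fun g => ?_⟩
  rw [← sub_eq_zero, ← norm_le_zero_iff]
  refine le_of_forall_pos_le_add fun ε hε => ?_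
  obtain ⟨R, hR⟩ := exists_norm_sub_aeval_lt g (half_pos hε)
  set F := MvPolynomial.aeval (ballCoord d) R with hF
  set p : CB d := ⟨w, mem_closedBall_zero_iff.2 hw1⟩ with hp
  have h1 : χ F = ballEval d p F := by
    rw [hF, MvPolynomial.comp_aeval_apply, MvPolynomial.comp_aeval_apply]
    rfl
  have h2 : χ g - ballEval d p g = χ (g - F) - ballEval d p (g - F) := by
    rw [map_sub, map_sub, h1]
    ring
  rw [h2]
  have h3 := norm_sub_le (χ (g - F)) (ballEval d p (g - F))
  have h4 := hχ (g - F)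
  have h5 := norm_ballEval_le d p (g - F)
  linarith

instance (d : ℕ) : NormOneClass (BallAlgebra d) where
  norm_one := by
    have : Nonempty (CB d) := ⟨⟨0, mem_closedBall_self zero_le_one⟩⟩
    exact norm_one (α := C(CB d, ℂ))

theorem exists_forall_ballEval_eq_zero_of_isMaximal {d : ℕ} (P : Ideal (BallAlgebra d))
    [hP : P.IsMaximal] : ∃ w : CB d, ∀ f, f ∈ P ↔ ballEval d w f = 0 := by
  obtain ⟨w, hw⟩ := exists_forall_eq_ballEval_of_algHom
    (WeakDual.CharacterSpace.toAlgHom (Ideal.toCharacterSpace (A := BallAlgebra d) P))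
    fun f => AlgHom.norm_apply_le_self (A := BallAlgebra d)
      (WeakDual.CharacterSpace.toAlgHom (Ideal.toCharacterSpace (A := BallAlgebra d) P)) f
  have hle : P ≤ RingHom.ker (ballEval d w) := fun f hf => by
    rw [RingHom.mem_ker, ← hw]
    exact Ideal.toCharacterSpace_apply_eq_zero_of_mem P hf
  have := hP.eq_of_le (RingHom.ker_ne_top _) hle
  refine ⟨w, fun f => ?_⟩
  rw [this, RingHom.mem_ker]

theorem mem_ballVanishingIdeal_of_dilation {d : ℕ} {l : EuclideanSpace ℂ (Fin d)} {r : ℝ}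
    (hr : 0 < r) {ρ : BallAlgebra d →ₐ[ℂ] BallAlgebra d}
    (hρ : ∀ (f : BallAlgebra d) (z w : CB d),
      w.1 = l + (r : ℂ) • z.1 → ballEval d z (ρ f) = ballEval d w f)
    {K : ℕ} {f : BallAlgebra d} (hf : ρ f ∈ ballVanishingIdeal 0 K) :
    f ∈ ballVanishingIdeal l K := by
  obtain ⟨C, hC⟩ := hf
  refine ⟨(|C| + ‖f‖) * r⁻¹ ^ K, fun w => ?_⟩
  rw [mul_assoc, ← mul_pow, add_mul]
  by_cases hw : ‖w.1 - l‖ ≤ r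
  · have hn : ‖(r : ℂ)⁻¹ • (w.1 - l)‖ = r⁻¹ * ‖w.1 - l‖ := by
      rw [norm_smul, norm_inv, Complex.norm_of_nonneg hr.le]
    have hm : (r : ℂ)⁻¹ • (w.1 - l) ∈ CB d := by
      rw [mem_closedBall_zero_iff, hn, inv_mul_le_iff₀ hr, mul_one]
      exact hw
    have hr' : (r : ℂ) ≠ 0 := Complex.ofReal_ne_zero.2 hr.ne'
    have h := hC ⟨_, hm⟩
    rw [hρ f ⟨_, hm⟩ w (by rw [smul_inv_smul₀ hr', add_sub_cancel]), sub_zero, hn] at h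
    have h1 : C * (r⁻¹ * ‖w.1 - l‖) ^ K ≤ |C| * (r⁻¹ * ‖w.1 - l‖) ^ K :=
      mul_le_mul_of_nonneg_right (le_abs_self C) (by positivity)
    have h2 : 0 ≤ ‖f‖ * (r⁻¹ * ‖w.1 - l‖) ^ K := by positivity
    linarith
  · have h1 : 1 ≤ (r⁻¹ * ‖w.1 - l‖) ^ K := by
      refine one_le_pow₀ ?_
      rw [le_inv_mul_iff₀ hr, mul_one]
      exact (not_le.1 hw).le
    have h2 : ‖f‖ ≤ ‖f‖ * (r⁻¹ * ‖w.1 - l‖) ^ K := le_mul_of_one_le_right (norm_nonneg _) h1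
    have h3 : 0 ≤ |C| * (r⁻¹ * ‖w.1 - l‖) ^ K := by positivity
    linarith [norm_ballEval_le d w f]

theorem exists_sub_mem_pow_of_dilation {d : ℕ} {l : EuclideanSpace ℂ (Fin d)} {r : ℝ}
    (hr : 0 < r) {ρ : BallAlgebra d →ₐ[ℂ] BallAlgebra d}
    (hρ : ∀ j, ρ (ballCoord d j - algebraMap ℂ _ (l j)) = algebraMap ℂ _ (r : ℂ) * ballCoord d j)
    (K : ℕ) (a : BallAlgebra d) :
    ∃ s, a - ρ s ∈ ballPointIdeal (0 : EuclideanSpace ℂ (Fin d)) ^ K := by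
  induction K generalizing a with
  | zero => exact ⟨0, by simp⟩
  | succ K ih =>
    obtain ⟨c, u, rfl⟩ := exists_gleason (0 : EuclideanSpace ℂ (Fin d)) (by simp) a
    choose s hs using fun j => ih (u j)
    have hr' : (r : ℂ) ≠ 0 := Complex.ofReal_ne_zero.2 hr.ne'
    refine ⟨algebraMap ℂ _ c + ∑ j, algebraMap ℂ _ (r : ℂ)⁻¹ *
      (ballCoord d j - algebraMap ℂ _ (l j)) * s j, ?_⟩
    have h1 : ∀ j, ρ (algebraMap ℂ _ (r : ℂ)⁻¹ * (ballCoord d j - algebraMap ℂ _ (l j)) * s j) =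
        ballCoord d j * ρ (s j) := fun j => by
      rw [map_mul, map_mul, hρ, AlgHom.commutes, ← mul_assoc, ← map_mul, inv_mul_cancel₀ hr',
        map_one, one_mul]
    rw [map_add, AlgHom.commutes, map_sum, add_sub_add_left_eq_sub, ← Finset.sum_sub_distrib]
    refine sum_mem fun j _ => ?_
    have h2 : (ballCoord d j - algebraMap ℂ (BallAlgebra d) ((0 : EuclideanSpace ℂ (Fin d)) j)) *
        u j - ballCoord d j * ρ (s j) = (ballCoord d j -
          algebraMap ℂ (BallAlgebra d) ((0 : EuclideanSpace ℂ (Fin d)) j)) * (u j - ρ (s j)) := by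
      have : algebraMap ℂ (BallAlgebra d) ((0 : EuclideanSpace ℂ (Fin d)) j) = 0 := by
        rw [PiLp.zero_apply, map_zero]
      rw [this]
      ring
    rw [h1, h2, pow_succ']
    exact Ideal.mul_mem_mul (Ideal.subset_span ⟨j, rfl⟩) (hs j)

theorem exists_sub_mem_of_mem_map {A B : Type*} [CommRing A] [CommRing B] (ρ : A →+* B)
    (I : Ideal A) (J : Ideal B) (hJ : ∀ b, ∃ s, b - ρ s ∈ J) {f : B} (hf : f ∈ I.map ρ) :
    ∃ g ∈ I, f - ρ g ∈ J := by
  induction hf using Submodule.span_induction with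
  | mem x hx =>
    obtain ⟨g, hg, rfl⟩ := hx
    exact ⟨g, hg, by rw [sub_self]; exact zero_mem _⟩
  | zero => exact ⟨0, zero_mem _, by simp⟩
  | add x y _ _ hx hy =>
    obtain ⟨p, hp, hp'⟩ := hx
    obtain ⟨q, hq, hq'⟩ := hy
    exact ⟨p + q, add_mem hp hq, by rw [map_add, add_sub_add_comm]; exact add_mem hp' hq'⟩
  | smul a x _ hx =>
    obtain ⟨p, hp, hp'⟩ := hx
    obtain ⟨s, hs⟩ := hJ a
    refine ⟨s * p, I.mul_mem_left _ hp, ?_⟩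
    have : a • x - ρ (s * p) = (a - ρ s) * x + ρ s * (x - ρ p) := by
      rw [map_mul, smul_eq_mul]
      ring
    rw [this]
    exact add_mem (J.mul_mem_right _ hs) (J.mul_mem_left _ hp')

theorem exists_pow_ballPointIdeal_le_sup {d : ℕ} (I : Ideal (BallAlgebra d))
    {l : EuclideanSpace ℂ (Fin d)} {r : ℝ} (hr : 0 < r) (hlr : ‖l‖ + r ≤ 1)
    (hI : ∀ w : CB d, (∀ f ∈ I, ballEval d w f = 0) → ‖w.1 - l‖ ≤ r → w.1 = l) :
    ∃ N, ballPointIdeal l ^ N ≤ ballPointIdeal l ^ (N + 1) ⊔ I := by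
  have hl : ‖l‖ < 1 := by linarith
  obtain ⟨ρ, hρ⟩ := exists_ballDilation l hr.le hlr
  have hρx := ballDilation_ballCoord hr.le hlr hρ
  have hr' : (r : ℂ) ≠ 0 := Complex.ofReal_ne_zero.2 hr.ne'
  obtain ⟨N, hN⟩ := exists_pow_span_le_of_isMaximal _
    (exists_gleason (0 : EuclideanSpace ℂ (Fin d)) (by simp)) (I.map ρ.toRingHom) (by
      intro P hP hIP j
      obtain ⟨w, hw⟩ := exists_forall_ballEval_eq_zero_of_isMaximal P
      have hwn : ‖w.1‖ ≤ 1 := mem_closedBall_zero_iff.1 w.2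
      have hn : ‖(r : ℂ) • w.1‖ ≤ r := by
        rw [norm_smul, Complex.norm_of_nonneg hr.le]
        exact mul_le_of_le_one_right hr.le hwn
      have hm : l + (r : ℂ) • w.1 ∈ CB d :=
        mem_closedBall_zero_iff.2 ((norm_add_le _ _).trans (by linarith))
      have h0 := hI ⟨_, hm⟩ (fun f hf => by
        rw [← hρ f w ⟨_, hm⟩ rfl]
        exact (hw _).1 (hIP (Ideal.mem_map_of_mem ρ.toRingHom hf)))
        (by rwa [add_sub_cancel_left])
      have hw0 : w.1 = 0 := by
        rw [add_eq_left] at h0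
        exact (smul_eq_zero.1 h0).resolve_left hr'
      rw [hw, map_sub, AlgHom.commutes, ballEval_ballCoord, hw0, sub_eq_zero]
      rfl)
  refine ⟨N, fun m hm => ?_⟩
  have hmap : (ballPointIdeal l).map ρ.toRingHom ≤
      ballPointIdeal (0 : EuclideanSpace ℂ (Fin d)) := by
    rw [ballPointIdeal, Ideal.map_span, Ideal.span_le]
    rintro _ ⟨_, ⟨j, rfl⟩, rfl⟩
    have h1 : ballCoord d j ∈ ballPointIdeal (0 : EuclideanSpace ℂ (Fin d)) :=
      Ideal.subset_span ⟨j, by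
        simp only [PiLp.zero_apply, map_zero, sub_zero]⟩
    have h2 := Ideal.mul_mem_left _ (algebraMap ℂ (BallAlgebra d) (r : ℂ)) h1
    rw [← hρx j] at h2
    exact h2
  have hρm : ρ m ∈ I.map ρ.toRingHom := by
    refine hN (Ideal.pow_right_mono hmap N ?_)
    rw [← Ideal.map_pow]
    exact Ideal.mem_map_of_mem ρ.toRingHom hm
  obtain ⟨g, hg, hmg⟩ := exists_sub_mem_of_mem_map ρ.toRingHom I _
    (exists_sub_mem_pow_of_dilation hr hρx (N + 1)) hρm
  have h1 : ρ (m - g) ∈ ballPointIdeal (0 : EuclideanSpace ℂ (Fin d)) ^ (N + 1) := by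
    rw [map_sub]
    exact hmg
  have h2 := ballVanishingIdeal_le_pow hl _ (mem_ballVanishingIdeal_of_dilation hr hρ
    (ballPointIdeal_pow_le_ballVanishingIdeal _ _ h1))
  rw [← sub_add_cancel m g]
  exact add_mem (Ideal.mem_sup_left h2) (Ideal.mem_sup_right hg)

/-- The ideal of functions in the ball algebra vanishing on a set. -/
def ballZeroIdeal {d : ℕ} (X : Set (CB d)) : Ideal (BallAlgebra d) where
  carrier := {f | ∀ z ∈ X, ballEval d z f = 0}
  zero_mem' := fun z _ => map_zero _
  add_mem' := fun {a b} ha hb z hz => by rw [map_add, ha z hz, hb z hz, add_zero]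
  smul_mem' := fun a b hb z hz => by rw [smul_eq_mul, map_mul, hb z hz, mul_zero]

theorem mem_ZS_IX_iff {d : ℕ} {X : Set (CB d)} {w : CB d} :
    w ∈ ZS d (IX d X) ↔ ∀ f ∈ ballZeroIdeal X, ballEval d w f = 0 :=
  ⟨fun h f hf => h f.1 ⟨f.2, hf⟩, fun h φ hφ => h ⟨φ, hφ.1⟩ hφ.2⟩

theorem exists_ballZeroIdeal_ballEval_ne_zero {d : ℕ} {X : Set (CB d)} {l : CB d} (hlX : l ∉ X)
    {r : ℝ} (hr : 0 < r) (hlr : ‖l.1‖ + r ≤ 1)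
    (h : ∀ w ∈ ZS d (IX d X), ‖w.1 - l.1‖ ≤ r → w = l) :
    ∃ f ∈ ballZeroIdeal X, ballEval d l f ≠ 0 := by
  by_contra! hl
  obtain ⟨N, hN⟩ := exists_pow_ballPointIdeal_le_sup (ballZeroIdeal X) hr hlr
    fun w hw hwl => congrArg Subtype.val (h w (mem_ZS_IX_iff.2 hw) hwl)
  obtain ⟨e, he, hee, hNe⟩ := exists_idempotent_mod _ _
    (Submodule.fg_span (finite_range _)) N hN
  have hle : ballPointIdeal l.1 ⊔ ballZeroIdeal X ≤ RingHom.ker (ballEval d l) := by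
    refine sup_le (Ideal.span_le.2 ?_) fun f hf => hl f hf
    rintro _ ⟨j, rfl⟩
    simp [RingHom.mem_ker]
  have hel : ballEval d l e = 0 := hle he
  have hmem : 1 - e ∈ ballZeroIdeal X := by
    intro z hz
    have hzl : z.1 ≠ l.1 := fun h => hlX (Subtype.ext h ▸ hz)
    obtain ⟨j, hj⟩ : ∃ j, z.1 j ≠ l.1 j := by
      by_contra! h'
      exact hzl (PiLp.ext h')
    have hxj : ballCoord d j - algebraMap ℂ _ (l.1 j) ∈ ballPointIdeal l.1 :=
      Ideal.subset_span ⟨j, rfl⟩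
    have hx := hNe (Ideal.pow_mem_pow hxj (N + 1))
    obtain ⟨a, ha, b, hb, hab⟩ := Submodule.mem_sup.1 hx
    obtain ⟨a, rfl⟩ := Ideal.mem_span_singleton'.1 ha
    have h1 := congrArg (ballEval d z) hab
    simp only [map_add, map_mul, map_pow, map_sub, AlgHom.commutes, ballEval_ballCoord] at h1
    rw [hb z hz, add_zero] at h1
    have h2 : ballEval d z e ≠ 0 := fun h0 => by
      rw [h0, mul_zero] at h1
      exact pow_ne_zero _ (sub_ne_zero.2 hj) h1.symm
    have h3 := hee z hz
    rw [map_sub, map_mul, sub_eq_zero] at h3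
    rw [map_sub, map_one, sub_eq_zero]
    exact (mul_right_cancel₀ h2 (h3.trans (one_mul _).symm)).symm
  have := hl _ hmem
  rw [map_sub, map_one, hel, sub_zero] at this
  exact one_ne_zero this

/-- the smallest zero set `Z(I(X₀))` containing `X₀ = X ∩ 𝕊_d` has no
isolated points in the open ball. -/
theorem stmt5 (d : ℕ) (hd : 1 ≤ d) (X : Set (CB d)) (hX : IsZeroSet d X) :
    ∀ z ∈ ZS d (IX d (X ∩ sphereD d)) ∩ openD d,
      ¬ IsIsolatedIn d (ZS d (IX d (X ∩ sphereD d)) ∩ openD d) z := by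
  rintro l ⟨hlZ, hl1⟩ ⟨-, U, hU, hUl⟩
  have hl1' : ‖l.1‖ < 1 := hl1
  have hlU : l ∈ U := (hUl.symm ▸ mem_singleton l : l ∈ U ∩ _).1
  obtain ⟨ε, hε, hεU⟩ := Metric.isOpen_iff.1 hU l hlU
  set r := min (ε / 2) ((1 - ‖l.1‖) / 2) with hr
  have hr1 : r ≤ ε / 2 := min_le_left _ _
  have hr2 : r ≤ (1 - ‖l.1‖) / 2 := min_le_right _ _
  have hr0 : 0 < r := lt_min (by linarith) (by linarith)
  obtain ⟨f, hf, hfl⟩ := exists_ballZeroIdeal_ballEval_ne_zero (X := X ∩ sphereD d) (l := l)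
    (fun h => hl1'.ne h.2) hr0 (by linarith) (by
      intro w hw hwl
      have hwU : w ∈ U := hεU (by
        rw [mem_ball, Subtype.dist_eq, dist_eq_norm]
        linarith)
      have hw1 : ‖w.1‖ < 1 := by
        have := norm_add_le (w.1 - l.1) l.1
        rw [sub_add_cancel] at this
        linarith
      have : w ∈ ({l} : Set (CB d)) := hUl ▸ ⟨hwU, hw, hw1⟩
      exact this)
  exact hfl (mem_ZS_IX_iff.1 hlZ f hf)

end
end
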